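/- The extended operator A : W̄ → W̄ is continuous, the image A(W̄) is uniformly bounded and equicontinuous, hence relatively compact in C(D); in particular, A : W̄ → W̄ is a compact operator and therefore (by the Schauder fixed-point theorem and a uniqueness argument) has a unique fixed point f₀ ∈ W̄. -/

import Mathlib

open Set MeasureTheory Filter Topology

noncomputable section

/-- The context of the BCS-Bogoliubov model: the cutoff `eps`, the Debye energy `om = ℏω_D`,
the potential `U` with bounds `U₁ ≤ U ≤ U₂`, the constant `a`, the temperatures
`tau₁, tau₂, T₀, Tc`, the solutions `Δ₁, Δ₂` of the constant-potential gap equations,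
the constant `Mz = max_{z ≥ 0} z / cosh z` and the constant `MT = M_T`. -/
structure BCSContext where
  eps : ℝ
  om : ℝ
  U : ℝ → ℝ → ℝ
  U₁ : ℝ
  U₂ : ℝ
  Umax : ℝ
  Umin : ℝ
  a : ℝ
  tau₁ : ℝ
  tau₂ : ℝ
  Δ₁ : ℝ → ℝ
  Δ₂ : ℝ → ℝ
  Tc : ℝ
  T₀ : ℝ
  Mz : ℝ
  MT : ℝ
  heps : 0 < eps
  hepsom : eps < om
  hU₁pos : 0 < U₁
  hU₁₂ : U₁ ≤ U₂
  hUsmooth : ContDiffOn ℝ 2 (fun p : ℝ × ℝ => U p.1 p.2) (Icc eps om ×ˢ Icc eps om)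
  hUlb : ∀ x ∈ Icc eps om, ∀ ξ ∈ Icc eps om, U₁ ≤ U x ξ
  hUub : ∀ x ∈ Icc eps om, ∀ ξ ∈ Icc eps om, U x ξ ≤ U₂
  hUmax : IsGreatest (Set.image2 U (Icc eps om) (Icc eps om)) Umax
  hUmin : IsLeast (Set.image2 U (Icc eps om) (Icc eps om)) Umin
  ha : a = (Umax / Umin) ^ 2
  htau₁pos : 0 < tau₁
  htau₂pos : 0 < tau₂
  htau₁ : 1 = U₁ * (∫ ξ in eps..om, Real.tanh (ξ / (2 * tau₁)) / ξ)
  htau₂ : 1 = U₂ * (∫ ξ in eps..om, Real.tanh (ξ / (2 * tau₂)) / ξ)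
  hΔ₁nonneg : ∀ T, 0 ≤ Δ₁ T
  hΔ₂nonneg : ∀ T, 0 ≤ Δ₂ T
  hΔ₁cont : Continuous Δ₁
  hΔ₂cont : Continuous Δ₂
  hΔ₁anti : StrictAntiOn Δ₁ (Icc 0 tau₁)
  hΔ₂anti : StrictAntiOn Δ₂ (Icc 0 tau₂)
  hΔ₁eq : ∀ T ∈ Ioc 0 tau₁, U₁ * (∫ ξ in eps..om,
      Real.tanh (Real.sqrt (ξ ^ 2 + Δ₁ T ^ 2) / (2 * T)) / Real.sqrt (ξ ^ 2 + Δ₁ T ^ 2)) = 1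
  hΔ₂eq : ∀ T ∈ Ioc 0 tau₂, U₂ * (∫ ξ in eps..om,
      Real.tanh (Real.sqrt (ξ ^ 2 + Δ₂ T ^ 2) / (2 * T)) / Real.sqrt (ξ ^ 2 + Δ₂ T ^ 2)) = 1
  hΔ₁zero : ∀ T, tau₁ ≤ T → Δ₁ T = 0
  hΔ₂zero : ∀ T, tau₂ ≤ T → Δ₂ T = 0
  hTc₁ : tau₁ ≤ Tc
  hTc₂ : Tc ≤ tau₂
  hT₀₁ : tau₁ < T₀
  hT₀₂ : T₀ < Tc
  hMz : IsGreatest ((fun z => z / Real.cosh z) '' Set.Ici (0 : ℝ)) Mz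
  hMT : MT = 4 * a * U₂ * Mz ^ 2 /
      (eps * U₁ *
        (Real.tanh (eps / (2 * Tc)) - (eps / (2 * Tc)) / Real.cosh (eps / (2 * Tc)) ^ 2) *
        (∫ ξ in eps..om, (ξ ^ 2 + Δ₂ 0 ^ 2) ^ (-(3 : ℝ) / 2)))

namespace BCSContext

/-- The energy interval `I = [ε, ℏω_D]`. -/
def Iset (C : BCSContext) : Set ℝ := Icc C.eps C.om

/-- The rectangle `D = [T₀, T_c] × I`. -/
def Dset (C : BCSContext) : Set (ℝ × ℝ) := Icc C.T₀ C.Tc ×ˢ Icc C.eps C.om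

end BCSContext

/-- The operator `A` of the squared BCS-Bogoliubov gap equation. -/
def opA (C : BCSContext) (f : ℝ → ℝ → ℝ) (T x : ℝ) : ℝ :=
  (∫ ξ in C.eps..C.om, C.U x ξ * Real.sqrt (f T ξ / (ξ ^ 2 + f T ξ)) *
      Real.tanh (Real.sqrt (ξ ^ 2 + f T ξ) / (2 * T))) ^ 2

/-- Partial derivative with respect to the temperature `T` (within `[T₀, T_c]`). -/
def pderivT (C : BCSContext) (g : ℝ → ℝ → ℝ) (T x : ℝ) : ℝ :=
  derivWithin (fun s => g s x) (Icc C.T₀ C.Tc) T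

/-- Partial derivative with respect to the energy `x` (within `I = [ε, ℏω_D]`). -/
def pderivX (C : BCSContext) (g : ℝ → ℝ → ℝ) (T x : ℝ) : ℝ :=
  derivWithin (fun y => g T y) (Icc C.eps C.om) x

/-- Membership in the set `W`. -/
def memW (C : BCSContext) (f : ℝ → ℝ → ℝ) : Prop :=
  ContDiffOn ℝ 2 (fun p : ℝ × ℝ => f p.1 p.2) C.Dset ∧
  (∀ T ∈ Icc C.T₀ C.Tc, ∀ x ∈ C.Iset, C.Δ₁ T ^ 2 ≤ f T x ∧ f T x ≤ C.Δ₂ T ^ 2) ∧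
  (∀ x ∈ C.Iset, f C.Tc x = 0) ∧
  (∀ T ∈ Ico C.T₀ C.Tc, ∀ x ∈ C.Iset, ∀ x₁ ∈ C.Iset, f T x ≤ C.a * f T x₁) ∧
  (∀ x ∈ C.Iset, ∀ x₁ ∈ C.Iset,
      -(pderivT C f C.Tc x) ≤ C.a * -(pderivT C f C.Tc x₁)) ∧
  (∀ T ∈ Icc C.T₀ C.Tc, ∀ x ∈ C.Iset, pderivT C f T x < 0) ∧
  (∀ T ∈ Icc C.T₀ C.Tc, ∀ x ∈ C.Iset, -(pderivT C f T x) ≤ C.MT)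

/-- The condition `a^{1/4} · max_{(T,x) ∈ D} ∫_I (U(x,ξ)/ξ) tanh(ξ/(2T)) dξ ≤ 1`. -/
def gapCondition (C : BCSContext) : Prop :=
  ∀ T ∈ Icc C.T₀ C.Tc, ∀ x ∈ C.Iset,
    C.a ^ ((1 : ℝ) / 4) * (∫ ξ in C.eps..C.om, C.U x ξ / ξ * Real.tanh (ξ / (2 * T))) ≤ 1

instance (C : BCSContext) : CompactSpace ↥C.Dset :=
  isCompact_iff_compactSpace.mp (isCompact_Icc.prod isCompact_Icc)

-- Extension of a continuous function on `D` to a function on `ℝ × ℝ` (by `0` outside `D`).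
open Classical in
def extFun (C : BCSContext) (F : C(↥C.Dset, ℝ)) : ℝ → ℝ → ℝ :=
  fun T x => if h : (T, x) ∈ C.Dset then F ⟨(T, x), h⟩ else 0

/-- The set `W` regarded as a subset of the Banach space `C(D)`. -/
def WSet (C : BCSContext) : Set C(↥C.Dset, ℝ) :=
  {F | ∃ f : ℝ → ℝ → ℝ, memW C f ∧ ∀ p : ↥C.Dset, F p = f (p : ℝ × ℝ).1 (p : ℝ × ℝ).2}


section Kernel

theorem hasDerivAt_tanh (z : ℝ) : HasDerivAt Real.tanh (1 / Real.cosh z ^ 2) z := by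
  have h : Real.tanh = fun z => Real.sinh z / Real.cosh z :=
    funext Real.tanh_eq_sinh_div_cosh
  have hc := (Real.cosh_pos z).ne'
  rw [h]
  refine ((Real.hasDerivAt_sinh z).div (Real.hasDerivAt_cosh z) hc).congr_deriv ?_
  rw [← Real.cosh_sq_sub_sinh_sq z]
  ring

theorem continuous_tanh : Continuous Real.tanh :=
  continuous_iff_continuousAt.2 fun z => (hasDerivAt_tanh z).continuousAt

theorem strictMono_tanh : StrictMono Real.tanh :=
  strictMono_of_hasDerivAt_pos hasDerivAt_tanh fun z => by
    have := Real.cosh_pos z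
    positivity

theorem tanh_nonneg {z : ℝ} (hz : 0 ≤ z) : 0 ≤ Real.tanh z := by
  simpa using strictMono_tanh.monotone hz

/-- The function `tanh z - z / cosh² z`. -/
def tanhDefect (z : ℝ) : ℝ := Real.tanh z - z / Real.cosh z ^ 2

theorem hasDerivAt_tanhDefect (z : ℝ) :
    HasDerivAt tanhDefect (2 * z * Real.sinh z / Real.cosh z ^ 3) z := by
  have hc := (Real.cosh_pos z).ne'
  refine ((hasDerivAt_tanh z).sub
    ((hasDerivAt_id z).div ((Real.hasDerivAt_cosh z).pow 2) (pow_ne_zero 2 hc))).congr_deriv ?_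
  simp only [id, Pi.pow_apply]
  field_simp
  ring

theorem strictMonoOn_tanhDefect : StrictMonoOn tanhDefect (Ici 0) := by
  refine strictMonoOn_of_deriv_pos (convex_Ici 0)
    (fun z _ => (hasDerivAt_tanhDefect z).continuousAt.continuousWithinAt) fun z hz => ?_
  rw [interior_Ici, mem_Ioi] at hz
  rw [(hasDerivAt_tanhDefect z).deriv]
  have := Real.sinh_pos_iff.2 hz
  have := Real.cosh_pos z
  positivity

theorem tanhDefect_pos {z : ℝ} (hz : 0 < z) : 0 < tanhDefect z := by
  simpa [tanhDefect] using strictMonoOn_tanhDefect self_mem_Ici hz.le hz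

/-- The kernel `tanh (E / 2T) / E` with `E = √(ξ² + s)`. -/
def gapKernel (T s ξ : ℝ) : ℝ := Real.tanh (√(ξ ^ 2 + s) / (2 * T)) / √(ξ ^ 2 + s)

theorem gapKernel_zero {T ξ : ℝ} (hξ : 0 ≤ ξ) : gapKernel T 0 ξ = Real.tanh (ξ / (2 * T)) / ξ := by
  simp [gapKernel, Real.sqrt_sq hξ]

theorem gapKernel_nonneg {T : ℝ} (hT : 0 ≤ T) (s ξ : ℝ) : 0 ≤ gapKernel T s ξ :=
  div_nonneg (tanh_nonneg (by positivity)) (Real.sqrt_nonneg _)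

theorem hasDerivAt_gapKernel_snd {T s ξ : ℝ} (hT : 0 < T) (h : 0 < ξ ^ 2 + s) :
    HasDerivAt (fun s => gapKernel T s ξ)
      (-(tanhDefect (√(ξ ^ 2 + s) / (2 * T)) / (2 * √(ξ ^ 2 + s) ^ 3))) s := by
  have hE : 0 < √(ξ ^ 2 + s) := Real.sqrt_pos.2 h
  have h1 : HasDerivAt (fun s => √(ξ ^ 2 + s)) (1 / (2 * √(ξ ^ 2 + s))) s :=
    ((hasDerivAt_id s).const_add (ξ ^ 2)).sqrt h.ne'
  have h2 := (hasDerivAt_tanh (√(ξ ^ 2 + s) / (2 * T))).comp s (h1.div_const (2 * T))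
  refine (h2.div h1 hE.ne').congr_deriv ?_
  have hc := (Real.cosh_pos (√(ξ ^ 2 + s) / (2 * T))).ne'
  simp only [Function.comp, tanhDefect]
  generalize √(ξ ^ 2 + s) = E at *
  generalize Real.cosh (E / (2 * T)) = c at *
  generalize Real.tanh (E / (2 * T)) = t at *
  field_simp
  ring

theorem hasDerivAt_gapKernel_fst {T s ξ : ℝ} (hT : 0 < T) (h : 0 < ξ ^ 2 + s) :
    HasDerivAt (fun T => gapKernel T s ξ)
      (-(2 / (ξ ^ 2 + s) *
        (√(ξ ^ 2 + s) / (2 * T) / Real.cosh (√(ξ ^ 2 + s) / (2 * T))) ^ 2)) T := by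
  have hE : 0 < √(ξ ^ 2 + s) := Real.sqrt_pos.2 h
  have h1 : HasDerivAt (fun T : ℝ => √(ξ ^ 2 + s) / (2 * T))
      ((0 * (2 * T) - √(ξ ^ 2 + s) * (2 * 1)) / (2 * T) ^ 2) T :=
    (hasDerivAt_const T _).div ((hasDerivAt_id T).const_mul 2) (by positivity)
  have h2 := ((hasDerivAt_tanh (√(ξ ^ 2 + s) / (2 * T))).comp T h1).div_const (√(ξ ^ 2 + s))
  refine h2.congr_deriv ?_
  have hc := (Real.cosh_pos (√(ξ ^ 2 + s) / (2 * T))).ne'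
  have hs : ξ ^ 2 + s = √(ξ ^ 2 + s) ^ 2 := (Real.sq_sqrt h.le).symm
  rw [show 2 / (ξ ^ 2 + s) = 2 / √(ξ ^ 2 + s) ^ 2 by rw [← hs]]
  generalize √(ξ ^ 2 + s) = E at *
  generalize Real.cosh (E / (2 * T)) = c at *
  field_simp
  ring

theorem gapKernel_sub_le_snd {T Tm s₀ s₁ S ξ e : ℝ} (hT : 0 < T) (hTm : T ≤ Tm) (he : 0 < e)
    (hξ : e ≤ ξ) (hs₀ : 0 ≤ s₀) (hs : s₀ ≤ s₁) (hS : s₁ ≤ S) :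
    gapKernel T s₁ ξ - gapKernel T s₀ ξ ≤
      -(tanhDefect (e / (2 * Tm)) / (2 * √(ξ ^ 2 + S) ^ 3)) * (s₁ - s₀) := by
  have hξ0 : 0 < ξ := he.trans_le hξ
  have hTm0 : 0 < Tm := hT.trans_le hTm
  have hd : ∀ s ∈ Icc 0 S, HasDerivAt (fun s => gapKernel T s ξ)
      (-(tanhDefect (√(ξ ^ 2 + s) / (2 * T)) / (2 * √(ξ ^ 2 + s) ^ 3))) s := fun s hs =>
    hasDerivAt_gapKernel_snd hT (by have := hs.1; positivity)
  refine (convex_Icc 0 S).image_sub_le_mul_sub_of_deriv_le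
    (fun s hs => (hd s hs).continuousAt.continuousWithinAt)
    (fun s hs => (hd s (interior_subset hs)).differentiableAt.differentiableWithinAt)
    (fun s hs => ?_) s₀ ⟨hs₀, hs.trans hS⟩ s₁ ⟨hs₀.trans hs, hS⟩ hs
  have hs' := interior_subset hs
  rw [(hd s hs').deriv]
  have h0 := hs'.1
  have hE : 0 < √(ξ ^ 2 + s) := Real.sqrt_pos.2 (by positivity)
  have hξE : ξ ≤ √(ξ ^ 2 + s) := Real.le_sqrt_of_sq_le (by linarith)
  have h1 : tanhDefect (e / (2 * Tm)) ≤ tanhDefect (√(ξ ^ 2 + s) / (2 * T)) := by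
    refine strictMonoOn_tanhDefect.monotoneOn (mem_Ici.2 (by positivity))
      (mem_Ici.2 (by positivity)) ?_
    gcongr
    exact hξ.trans hξE
  have h2 := tanhDefect_pos (show 0 < e / (2 * Tm) by positivity)
  have h3 : √(ξ ^ 2 + s) ≤ √(ξ ^ 2 + S) := Real.sqrt_le_sqrt (by linarith [hs'.2])
  have h4 := h2.le.trans h1
  gcongr

theorem gapKernel_anti_snd {T s₀ s₁ ξ : ℝ} (hT : 0 < T) (hξ : 0 < ξ) (hs₀ : 0 ≤ s₀)
    (hs : s₀ ≤ s₁) : gapKernel T s₁ ξ ≤ gapKernel T s₀ ξ := by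
  have h := gapKernel_sub_le_snd hT le_rfl hξ le_rfl hs₀ hs le_rfl
  have := tanhDefect_pos (show 0 < ξ / (2 * T) by positivity)
  have : 0 ≤ tanhDefect (ξ / (2 * T)) / (2 * √(ξ ^ 2 + s₁) ^ 3) * (s₁ - s₀) :=
    mul_nonneg (by positivity) (by linarith)
  linarith

theorem gapKernel_lt_snd {T s ξ : ℝ} (hT : 0 < T) (hξ : 0 < ξ) (hs : 0 < s) :
    gapKernel T s ξ < gapKernel T 0 ξ := by
  have h := gapKernel_sub_le_snd hT le_rfl hξ le_rfl le_rfl hs.le le_rfl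
  have := tanhDefect_pos (show 0 < ξ / (2 * T) by positivity)
  have : 0 < tanhDefect (ξ / (2 * T)) / (2 * √(ξ ^ 2 + s) ^ 3) * (s - 0) := by
    rw [sub_zero]; positivity
  linarith

theorem gapKernel_anti_fst {T₁ T₂ : ℝ} (hT₁ : 0 < T₁) (hT : T₁ ≤ T₂) (s ξ : ℝ) :
    gapKernel T₂ s ξ ≤ gapKernel T₁ s ξ := by
  unfold gapKernel
  gcongr
  apply strictMono_tanh.monotone
  gcongr

theorem gapKernel_sub_le_fst {T₁ T₂ s ξ M : ℝ} (hT₁ : 0 < T₁) (hT : T₁ ≤ T₂) (hξ : 0 < ξ)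
    (hs : 0 ≤ s) (hM : ∀ z, 0 ≤ z → z / Real.cosh z ≤ M) :
    gapKernel T₁ s ξ - gapKernel T₂ s ξ ≤ 2 * M ^ 2 / ξ ^ 2 * (T₂ - T₁) := by
  have hd : ∀ T ∈ Ici T₁, HasDerivAt (fun T => gapKernel T s ξ)
      (-(2 / (ξ ^ 2 + s) *
        (√(ξ ^ 2 + s) / (2 * T) / Real.cosh (√(ξ ^ 2 + s) / (2 * T))) ^ 2)) T := fun T hT =>
    hasDerivAt_gapKernel_fst (hT₁.trans_le hT) (by positivity)
  have h := (convex_Ici T₁).mul_sub_le_image_sub_of_le_deriv (C := -(2 * M ^ 2 / ξ ^ 2))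
    (fun T hT => (hd T hT).continuousAt.continuousWithinAt)
    (fun T hT => (hd T (interior_subset hT)).differentiableAt.differentiableWithinAt)
    (fun T hT => ?_) T₁ self_mem_Ici T₂ hT hT
  · linarith
  · have hT' := interior_subset hT
    rw [(hd T hT').deriv]
    have hT0 : 0 < T := hT₁.trans_le hT'
    have hz : 0 ≤ √(ξ ^ 2 + s) / (2 * T) := by positivity
    have h1 := hM _ hz
    have hc := Real.cosh_pos (√(ξ ^ 2 + s) / (2 * T))
    have h2 : 0 ≤ √(ξ ^ 2 + s) / (2 * T) / Real.cosh (√(ξ ^ 2 + s) / (2 * T)) := by positivity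
    have h3 : 2 / (ξ ^ 2 + s) * (√(ξ ^ 2 + s) / (2 * T) /
        Real.cosh (√(ξ ^ 2 + s) / (2 * T))) ^ 2 ≤ 2 / ξ ^ 2 * M ^ 2 := by
      gcongr
      linarith
    have h4 : 2 / ξ ^ 2 * M ^ 2 = 2 * M ^ 2 / ξ ^ 2 := by ring
    linarith

theorem gapKernel_le {T s ξ e : ℝ} (he : 0 < e) (hξ : e ≤ ξ) (hs : 0 ≤ s) :
    gapKernel T s ξ ≤ 1 / e := by
  have hE : e ≤ √(ξ ^ 2 + s) := hξ.trans (Real.le_sqrt_of_sq_le (by linarith))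
  unfold gapKernel
  gcongr
  exact (Real.tanh_lt_one _).le

theorem continuousOn_gapKernel {φ : ℝ → ℝ} {S : Set ℝ} (T : ℝ) (hφ : ContinuousOn φ S)
    (h : ∀ ξ ∈ S, 0 < ξ ^ 2 + φ ξ) : ContinuousOn (fun ξ => gapKernel T (φ ξ) ξ) S := by
  have h1 : ContinuousOn (fun ξ => √(ξ ^ 2 + φ ξ)) S := by fun_prop
  exact (continuous_tanh.comp_continuousOn (h1.div_const _)).div h1
    fun ξ hξ => (Real.sqrt_pos.2 (h ξ hξ)).ne'

theorem sqrt_div_mul_tanh (T s ξ : ℝ) (hs : 0 ≤ s) :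
    √(s / (ξ ^ 2 + s)) * Real.tanh (√(ξ ^ 2 + s) / (2 * T)) = √s * gapKernel T s ξ := by
  rw [Real.sqrt_div hs, gapKernel]
  ring

theorem sqrt_mul_gapKernel_mono {T s₀ s₁ ξ : ℝ} (hT : 0 ≤ T) (hξ : 0 < ξ) (hs₀ : 0 ≤ s₀)
    (hs : s₀ ≤ s₁) : √s₀ * gapKernel T s₀ ξ ≤ √s₁ * gapKernel T s₁ ξ := by
  rw [← sqrt_div_mul_tanh _ _ _ hs₀, ← sqrt_div_mul_tanh _ _ _ (hs₀.trans hs)]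
  have h0 : 0 ≤ √(ξ ^ 2 + s₀) / (2 * T) := by positivity
  refine mul_le_mul (Real.sqrt_le_sqrt ?_) (strictMono_tanh.monotone (by gcongr))
    (tanh_nonneg h0) (Real.sqrt_nonneg _)
  rw [div_le_div_iff₀ (by positivity) (by have := hs₀.trans hs; positivity)]
  nlinarith [sq_nonneg ξ]

theorem sqrt_mul_gapKernel_le_one {T s ξ : ℝ} (hT : 0 ≤ T) (hs : 0 ≤ s) :
    √s * gapKernel T s ξ ≤ 1 := by
  rw [← sqrt_div_mul_tanh _ _ _ hs]
  have h0 : 0 ≤ √(ξ ^ 2 + s) / (2 * T) := by positivity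
  refine mul_le_one₀ (Real.sqrt_le_one.2 (div_le_one_of_le₀ ?_ (by positivity))) (tanh_nonneg h0)
    (Real.tanh_lt_one _).le
  linarith [sq_nonneg ξ]

theorem abs_sqrt_mul_gapKernel_sub_le {T s₀ s₁ ξ e d : ℝ} (hT : 0 < T) (he : 0 < e) (hξ : e ≤ ξ)
    (hs₀ : 0 ≤ s₀) (hs₁ : 0 ≤ s₁) (hd : |s₁ - s₀| ≤ d) :
    |√s₁ * gapKernel T s₁ ξ - √s₀ * gapKernel T s₀ ξ| ≤ √d / e := by
  wlog h : s₀ ≤ s₁ generalizing s₀ s₁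
  · rw [abs_sub_comm] at hd ⊢
    exact this hs₁ hs₀ hd (le_of_not_ge h)
  have hξ0 := he.trans_le hξ
  rw [abs_of_nonneg (sub_nonneg.2 (sqrt_mul_gapKernel_mono hT.le hξ0 hs₀ h))]
  rw [abs_of_nonneg (sub_nonneg.2 h)] at hd
  have h1 := gapKernel_anti_snd hT hξ0 hs₀ h
  have h2 : √s₁ ≤ √s₀ + √d := by
    refine Real.sqrt_le_iff.2 ⟨by positivity, ?_⟩
    have h3 := Real.sq_sqrt hs₀
    have h4 := Real.sq_sqrt ((sub_nonneg.2 h).trans hd)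
    nlinarith [Real.sqrt_nonneg s₀, Real.sqrt_nonneg d]
  have h5 := gapKernel_le (T := T) he hξ hs₀
  calc √s₁ * gapKernel T s₁ ξ - √s₀ * gapKernel T s₀ ξ
      ≤ √s₁ * gapKernel T s₀ ξ - √s₀ * gapKernel T s₀ ξ := by gcongr
    _ = (√s₁ - √s₀) * gapKernel T s₀ ξ := by ring
    _ ≤ √d * (1 / e) := mul_le_mul (by linarith) h5 (gapKernel_nonneg hT.le _ _) (by positivity)
    _ = √d / e := by ring

end Kernel

namespace BCSContext

variable (C : BCSContext)

theorem pos_of_mem_Icc {ξ : ℝ} (hξ : ξ ∈ Icc C.eps C.om) : 0 < ξ := C.heps.trans_le hξ.1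

theorem T₀_pos : 0 < C.T₀ := C.htau₁pos.trans C.hT₀₁

theorem temp_pos {T : ℝ} (hT : T ∈ Icc C.T₀ C.Tc) : 0 < T := C.T₀_pos.trans_le hT.1

theorem temp_mem_Ioc {T : ℝ} (hT : T ∈ Icc C.T₀ C.Tc) : T ∈ Ioc 0 C.tau₂ :=
  ⟨C.temp_pos hT, hT.2.trans C.hTc₂⟩

theorem U₂_pos : 0 < C.U₂ := C.hU₁pos.trans_le C.hU₁₂

theorem U_pos {x ξ : ℝ} (hx : x ∈ Icc C.eps C.om) (hξ : ξ ∈ Icc C.eps C.om) : 0 < C.U x ξ :=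
  C.hU₁pos.trans_le (C.hUlb x hx ξ hξ)

theorem Umin_pos : 0 < C.Umin := by
  obtain ⟨x, hx, ξ, hξ, h⟩ := C.hUmin.1
  exact h ▸ C.U_pos hx hξ

theorem Umin_le_Umax : C.Umin ≤ C.Umax := C.hUmin.2 C.hUmax.1

theorem one_le_ratio : 1 ≤ C.Umax / C.Umin := (one_le_div C.Umin_pos).2 C.Umin_le_Umax

theorem one_le_a : 1 ≤ C.a := C.ha ▸ one_le_pow₀ C.one_le_ratio

theorem U_le_ratio_mul {x x₁ ξ : ℝ} (hx : x ∈ Icc C.eps C.om) (hx₁ : x₁ ∈ Icc C.eps C.om)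
    (hξ : ξ ∈ Icc C.eps C.om) : C.U x ξ ≤ C.Umax / C.Umin * C.U x₁ ξ := by
  have h1 : C.U x ξ ≤ C.Umax := C.hUmax.2 (mem_image2_of_mem hx hξ)
  have h2 : C.Umin ≤ C.U x₁ ξ := C.hUmin.2 (mem_image2_of_mem hx₁ hξ)
  have h3 := C.Umin_pos
  calc C.U x ξ ≤ C.Umax / C.Umin * C.Umin := by rwa [div_mul_cancel₀ _ h3.ne']
    _ ≤ _ := mul_le_mul_of_nonneg_left h2 (zero_le_one.trans C.one_le_ratio)

theorem continuousOn_U : ContinuousOn (fun p : ℝ × ℝ => C.U p.1 p.2)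
    (Icc C.eps C.om ×ˢ Icc C.eps C.om) := C.hUsmooth.continuousOn

theorem continuousOn_U_right {x : ℝ} (hx : x ∈ Icc C.eps C.om) :
    ContinuousOn (C.U x) (Icc C.eps C.om) :=
  C.continuousOn_U.comp (f := fun ξ => (x, ξ)) (by fun_prop) fun _ hξ => ⟨hx, hξ⟩

theorem continuousOn_gapKernel_comp {φ : ℝ → ℝ} (T : ℝ) (hφ : ContinuousOn φ (Icc C.eps C.om))
    (h0 : ∀ ξ ∈ Icc C.eps C.om, 0 ≤ φ ξ) :
    ContinuousOn (fun ξ => gapKernel T (φ ξ) ξ) (Icc C.eps C.om) :=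
  continuousOn_gapKernel T hφ fun ξ hξ =>
    add_pos_of_pos_of_nonneg (pow_pos (C.pos_of_mem_Icc hξ) 2) (h0 ξ hξ)

theorem le_Mz {z : ℝ} (hz : 0 ≤ z) : z / Real.cosh z ≤ C.Mz := C.hMz.2 ⟨z, hz, rfl⟩

theorem Mz_pos : 0 < C.Mz :=
  (div_pos one_pos (Real.cosh_pos 1)).trans_le (C.le_Mz zero_le_one)

theorem integral_mono {f g : ℝ → ℝ} (hf : ContinuousOn f (Icc C.eps C.om))
    (hg : ContinuousOn g (Icc C.eps C.om)) (h : ∀ ξ ∈ Icc C.eps C.om, f ξ ≤ g ξ) :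
    ∫ ξ in C.eps..C.om, f ξ ≤ ∫ ξ in C.eps..C.om, g ξ :=
  intervalIntegral.integral_mono_on C.hepsom.le (hf.intervalIntegrable_of_Icc C.hepsom.le)
    (hg.intervalIntegrable_of_Icc C.hepsom.le) h

theorem integral_congr_Icc {f g : ℝ → ℝ} (h : ∀ ξ ∈ Icc C.eps C.om, f ξ = g ξ) :
    ∫ ξ in C.eps..C.om, f ξ = ∫ ξ in C.eps..C.om, g ξ :=
  intervalIntegral.integral_congr fun _ hξ => h _ (by rwa [uIcc_of_le C.hepsom.le] at hξ)

theorem integral_add_of_continuousOn {f g : ℝ → ℝ} (hf : ContinuousOn f (Icc C.eps C.om))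
    (hg : ContinuousOn g (Icc C.eps C.om)) :
    ∫ ξ in C.eps..C.om, (f ξ + g ξ) =
      (∫ ξ in C.eps..C.om, f ξ) + ∫ ξ in C.eps..C.om, g ξ :=
  intervalIntegral.integral_add (hf.intervalIntegrable_of_Icc C.hepsom.le)
    (hg.intervalIntegrable_of_Icc C.hepsom.le)

theorem integral_sub_of_continuousOn {f g : ℝ → ℝ} (hf : ContinuousOn f (Icc C.eps C.om))
    (hg : ContinuousOn g (Icc C.eps C.om)) :
    ∫ ξ in C.eps..C.om, (f ξ - g ξ) =
      (∫ ξ in C.eps..C.om, f ξ) - ∫ ξ in C.eps..C.om, g ξ :=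
  intervalIntegral.integral_sub (hf.intervalIntegrable_of_Icc C.hepsom.le)
    (hg.intervalIntegrable_of_Icc C.hepsom.le)

theorem integral_nonneg_Icc {f : ℝ → ℝ} (h : ∀ ξ ∈ Icc C.eps C.om, 0 ≤ f ξ) :
    0 ≤ ∫ ξ in C.eps..C.om, f ξ :=
  intervalIntegral.integral_nonneg C.hepsom.le h

/-- The integral operator whose square is `opA`, applied to a nonnegative energy profile `φ`. -/
def gapIntegral (T x : ℝ) (φ : ℝ → ℝ) : ℝ :=
  ∫ ξ in C.eps..C.om, C.U x ξ * (√(φ ξ) * gapKernel T (φ ξ) ξ)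

theorem opA_eq {f : ℝ → ℝ → ℝ} {T : ℝ} (hf : ∀ ξ ∈ Icc C.eps C.om, 0 ≤ f T ξ) (x : ℝ) :
    opA C f T x = C.gapIntegral T x (f T) ^ 2 := by
  unfold opA gapIntegral
  congr 1
  exact C.integral_congr_Icc fun ξ hξ => by
    rw [mul_assoc, sqrt_div_mul_tanh _ _ _ (hf ξ hξ)]

/-- A continuous nonnegative function of the energy. -/
structure IsProfile (φ : ℝ → ℝ) : Prop where
  cont : ContinuousOn φ (Icc C.eps C.om)
  nonneg : ∀ ξ ∈ Icc C.eps C.om, 0 ≤ φ ξ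

variable {C} {T x : ℝ} {φ ψ : ℝ → ℝ}

theorem isProfile_const {c : ℝ} (hc : 0 ≤ c) : C.IsProfile fun _ => c :=
  ⟨continuousOn_const, fun _ _ => hc⟩

theorem IsProfile.continuousOn_sqrt (hφ : C.IsProfile φ) :
    ContinuousOn (fun ξ => √(φ ξ)) (Icc C.eps C.om) := hφ.cont.sqrt

theorem IsProfile.continuousOn_kernel (hφ : C.IsProfile φ) (T : ℝ) :
    ContinuousOn (fun ξ => gapKernel T (φ ξ) ξ) (Icc C.eps C.om) :=
  C.continuousOn_gapKernel_comp T hφ.cont hφ.nonneg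

theorem IsProfile.continuousOn_integrand (hφ : C.IsProfile φ) (T : ℝ)
    (hx : x ∈ Icc C.eps C.om) :
    ContinuousOn (fun ξ => C.U x ξ * (√(φ ξ) * gapKernel T (φ ξ) ξ)) (Icc C.eps C.om) :=
  (C.continuousOn_U_right hx).mul (hφ.continuousOn_sqrt.mul (hφ.continuousOn_kernel T))

theorem gapIntegral_nonneg (hT : 0 ≤ T) (hx : x ∈ Icc C.eps C.om) (φ : ℝ → ℝ) :
    0 ≤ C.gapIntegral T x φ :=
  C.integral_nonneg_Icc fun _ hξ => mul_nonneg (C.U_pos hx hξ).le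
    (mul_nonneg (Real.sqrt_nonneg _) (gapKernel_nonneg hT _ _))

theorem abs_integral_le_mul {f : ℝ → ℝ} {M : ℝ} (h : ∀ ξ ∈ Icc C.eps C.om, |f ξ| ≤ M) :
    |∫ ξ in C.eps..C.om, f ξ| ≤ M * (C.om - C.eps) := by
  have := intervalIntegral.norm_integral_le_of_norm_le_const (a := C.eps) (b := C.om) (f := f)
    (C := M) fun _ hξ => h _ (by
      rw [uIoc_of_le C.hepsom.le] at hξ
      exact ⟨hξ.1.le, hξ.2⟩)
  rwa [abs_of_pos (sub_pos.2 C.hepsom)] at this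

theorem gapIntegral_le (hT : 0 ≤ T) (hx : x ∈ Icc C.eps C.om) (hφ : C.IsProfile φ) :
    C.gapIntegral T x φ ≤ C.U₂ * (C.om - C.eps) := by
  refine (le_abs_self _).trans (abs_integral_le_mul fun ξ hξ => ?_)
  have h1 := (C.U_pos hx hξ).le
  have h2 : 0 ≤ √(φ ξ) * gapKernel T (φ ξ) ξ :=
    mul_nonneg (Real.sqrt_nonneg _) (gapKernel_nonneg hT _ _)
  rw [abs_of_nonneg (mul_nonneg h1 h2)]
  simpa using mul_le_mul (C.hUub x hx ξ hξ)
    (sqrt_mul_gapKernel_le_one (ξ := ξ) hT (hφ.nonneg ξ hξ)) h2 C.U₂_pos.le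

theorem gapIntegral_mono {T₁ T₂ : ℝ} (hT₁ : 0 < T₁) (hT : T₁ ≤ T₂) (hx : x ∈ Icc C.eps C.om)
    (hφ : C.IsProfile φ) (hψ : C.IsProfile ψ) (h : ∀ ξ ∈ Icc C.eps C.om, φ ξ ≤ ψ ξ) :
    C.gapIntegral T₂ x φ ≤ C.gapIntegral T₁ x ψ := by
  refine C.integral_mono (hφ.continuousOn_integrand T₂ hx) (hψ.continuousOn_integrand T₁ hx)
    fun ξ hξ => mul_le_mul_of_nonneg_left ?_ (C.U_pos hx hξ).le
  calc √(φ ξ) * gapKernel T₂ (φ ξ) ξ ≤ √(φ ξ) * gapKernel T₁ (φ ξ) ξ :=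
        mul_le_mul_of_nonneg_left (gapKernel_anti_fst hT₁ hT _ _) (Real.sqrt_nonneg _)
    _ ≤ √(ψ ξ) * gapKernel T₁ (ψ ξ) ξ :=
        sqrt_mul_gapKernel_mono hT₁.le (C.pos_of_mem_Icc hξ) (hφ.nonneg ξ hξ) (h ξ hξ)

theorem abs_gapIntegral_sub_le (hT : 0 < T) (hx : x ∈ Icc C.eps C.om) (hφ : C.IsProfile φ)
    (hψ : C.IsProfile ψ) {d : ℝ} (h : ∀ ξ ∈ Icc C.eps C.om, |φ ξ - ψ ξ| ≤ d) :
    |C.gapIntegral T x φ - C.gapIntegral T x ψ| ≤ C.U₂ * (√d / C.eps) * (C.om - C.eps) := by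
  unfold gapIntegral
  rw [← C.integral_sub_of_continuousOn (hφ.continuousOn_integrand T hx)
    (hψ.continuousOn_integrand T hx)]
  refine abs_integral_le_mul fun ξ hξ => ?_
  rw [← mul_sub, abs_mul, abs_of_pos (C.U_pos hx hξ)]
  exact mul_le_mul (C.hUub x hx ξ hξ) (abs_sqrt_mul_gapKernel_sub_le hT C.heps hξ.1
    (hψ.nonneg ξ hξ) (hφ.nonneg ξ hξ) (h ξ hξ)) (abs_nonneg _) C.U₂_pos.le

theorem abs_gapIntegral_sub_le_of_abs_U_sub_le (hT : 0 ≤ T) {y : ℝ} (hx : x ∈ Icc C.eps C.om)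
    (hy : y ∈ Icc C.eps C.om) (hφ : C.IsProfile φ) {r : ℝ}
    (h : ∀ ξ ∈ Icc C.eps C.om, |C.U x ξ - C.U y ξ| ≤ r) :
    |C.gapIntegral T x φ - C.gapIntegral T y φ| ≤ r * (C.om - C.eps) := by
  unfold gapIntegral
  rw [← C.integral_sub_of_continuousOn (hφ.continuousOn_integrand T hx)
    (hφ.continuousOn_integrand T hy)]
  refine abs_integral_le_mul fun ξ hξ => ?_
  have h2 : 0 ≤ √(φ ξ) * gapKernel T (φ ξ) ξ :=
    mul_nonneg (Real.sqrt_nonneg _) (gapKernel_nonneg hT _ _)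
  rw [← sub_mul, abs_mul, abs_of_nonneg h2]
  simpa using mul_le_mul (h ξ hξ) (sqrt_mul_gapKernel_le_one (ξ := ξ) hT (hφ.nonneg ξ hξ)) h2
    ((abs_nonneg _).trans (h ξ hξ))

theorem gapIntegral_le_Δ₂ (hT : T ∈ Icc C.T₀ C.Tc) (hx : x ∈ Icc C.eps C.om)
    (hφ : C.IsProfile φ) (h : ∀ ξ ∈ Icc C.eps C.om, φ ξ ≤ C.Δ₂ T ^ 2) :
    C.gapIntegral T x φ ≤ C.Δ₂ T := by
  have hT0 := C.temp_pos hT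
  have hc : C.IsProfile fun _ => C.Δ₂ T ^ 2 := isProfile_const (sq_nonneg _)
  have hcont := (hc.continuousOn_kernel T).const_mul (C.U₂ * C.Δ₂ T)
  calc C.gapIntegral T x φ ≤ C.gapIntegral T x fun _ => C.Δ₂ T ^ 2 :=
        gapIntegral_mono hT0 le_rfl hx hφ hc h
    _ ≤ ∫ ξ in C.eps..C.om, C.U₂ * C.Δ₂ T * gapKernel T (C.Δ₂ T ^ 2) ξ := by
        refine C.integral_mono (hc.continuousOn_integrand T hx) hcont fun ξ hξ => ?_
        rw [Real.sqrt_sq (C.hΔ₂nonneg T), mul_assoc C.U₂]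
        exact mul_le_mul_of_nonneg_right (C.hUub x hx ξ hξ)
          (mul_nonneg (C.hΔ₂nonneg T) (gapKernel_nonneg hT0.le _ _))
    _ = C.Δ₂ T * (C.U₂ * ∫ ξ in C.eps..C.om, gapKernel T (C.Δ₂ T ^ 2) ξ) := by
        rw [intervalIntegral.integral_const_mul]
        ring
    _ = C.Δ₂ T := by
        unfold gapKernel
        rw [C.hΔ₂eq T (C.temp_mem_Ioc hT), mul_one]

theorem gapIntegral_le_ratio_mul (hT : 0 ≤ T) {x₁ : ℝ} (hx : x ∈ Icc C.eps C.om)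
    (hx₁ : x₁ ∈ Icc C.eps C.om) (hφ : C.IsProfile φ) :
    C.gapIntegral T x φ ≤ C.Umax / C.Umin * C.gapIntegral T x₁ φ := by
  unfold gapIntegral
  rw [← intervalIntegral.integral_const_mul]
  refine C.integral_mono (hφ.continuousOn_integrand T hx)
    ((hφ.continuousOn_integrand T hx₁).const_mul _) fun ξ hξ => ?_
  rw [← mul_assoc (C.Umax / C.Umin)]
  exact mul_le_mul_of_nonneg_right (C.U_le_ratio_mul hx hx₁ hξ)
    (mul_nonneg (Real.sqrt_nonneg _) (gapKernel_nonneg hT _ _))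

theorem gapIntegral_of_eq_zero (h : ∀ ξ ∈ Icc C.eps C.om, φ ξ = 0) (T x : ℝ) :
    C.gapIntegral T x φ = 0 := by
  unfold gapIntegral
  rw [C.integral_congr_Icc (g := fun _ => 0) fun ξ hξ => by simp [h ξ hξ]]
  simp

/-- The integral entering the smallness condition `gapCondition`. -/
theorem ratio_mul_sq_integral_le_one (hcond : gapCondition C) (hT : T ∈ Icc C.T₀ C.Tc)
    (hx : x ∈ Icc C.eps C.om) :
    C.Umax / C.Umin * (∫ ξ in C.eps..C.om, C.U x ξ * gapKernel T 0 ξ) ^ 2 ≤ 1 := by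
  have h := hcond T hT x hx
  have hr := zero_le_one.trans C.one_le_ratio
  have h2 : (C.a ^ ((1 : ℝ) / 4)) ^ 2 = C.Umax / C.Umin := by
    rw [C.ha, ← Real.rpow_natCast _ 2, ← Real.rpow_natCast _ 2, ← Real.rpow_mul hr,
      ← Real.rpow_mul hr]
    norm_num
  have h3 : ∫ ξ in C.eps..C.om, C.U x ξ * gapKernel T 0 ξ =
      ∫ ξ in C.eps..C.om, C.U x ξ / ξ * Real.tanh (ξ / (2 * T)) :=
    C.integral_congr_Icc fun ξ hξ => by
      rw [gapKernel_zero (C.pos_of_mem_Icc hξ).le]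
      ring
  have h4 : 0 ≤ ∫ ξ in C.eps..C.om, C.U x ξ * gapKernel T 0 ξ :=
    C.integral_nonneg_Icc fun _ hξ => mul_nonneg (C.U_pos hx hξ).le
      (gapKernel_nonneg (C.temp_pos hT).le _ _)
  rw [← h3] at h
  rw [← h2, ← mul_pow]
  exact pow_le_one₀ (mul_nonneg (Real.rpow_nonneg (zero_le_one.trans C.one_le_a) _) h4) h

end BCSContext

theorem rpow_neg_three_half {y : ℝ} (hy : 0 < y) : y ^ (-(3 : ℝ) / 2) = 1 / √y ^ 3 := by
  rw [Real.sqrt_eq_rpow, ← Real.rpow_natCast, ← Real.rpow_mul hy.le, one_div,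
    ← Real.rpow_neg hy.le]
  norm_num

theorem integral_one_div_sq_le {e b : ℝ} (he : 0 < e) (heb : e ≤ b) :
    ∫ ξ in e..b, 1 / ξ ^ 2 ≤ 1 / e := by
  have hd : ∀ ξ ∈ uIcc e b, HasDerivAt (fun ξ : ℝ => -ξ⁻¹) (1 / ξ ^ 2) ξ := fun ξ hξ => by
    rw [uIcc_of_le heb] at hξ
    refine (hasDerivAt_inv (he.trans_le hξ.1).ne').neg.congr_deriv ?_
    rw [neg_neg, one_div]
  have hc : ContinuousOn (fun ξ : ℝ => 1 / ξ ^ 2) (uIcc e b) := by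
    rw [uIcc_of_le heb]
    exact continuousOn_const.div (by fun_prop) fun ξ hξ =>
      pow_ne_zero 2 (he.trans_le hξ.1).ne'
  rw [intervalIntegral.integral_eq_sub_of_hasDerivAt hd hc.intervalIntegrable]
  have : 0 < b⁻¹ := inv_pos.2 (he.trans_le heb)
  rw [one_div]
  linarith

namespace BCSContext

variable {C : BCSContext} {φ ψ : ℝ → ℝ}

theorem sqrt_ratio_sq_le {s t : ℝ} (h : s ≤ C.a * t) : √s ≤ C.Umax / C.Umin * √t := by
  rw [C.ha] at h
  have hr := zero_le_one.trans C.one_le_ratio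
  calc √s ≤ √((C.Umax / C.Umin) ^ 2 * t) := Real.sqrt_le_sqrt h
    _ = _ := by rw [Real.sqrt_mul (sq_nonneg _), Real.sqrt_sq hr]

variable (C) in
/-- The integral `∫ (ξ² + Δ₂(0)²)^(-3/2) dξ` entering `M_T`. -/
def cubeIntegral : ℝ := ∫ ξ in C.eps..C.om, 1 / √(ξ ^ 2 + C.Δ₂ 0 ^ 2) ^ 3

variable (C) in
theorem continuousOn_cube :
    ContinuousOn (fun ξ => 1 / √(ξ ^ 2 + C.Δ₂ 0 ^ 2) ^ 3) (Icc C.eps C.om) := by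
  refine continuousOn_const.div (by fun_prop) fun ξ hξ => ?_
  have := C.pos_of_mem_Icc hξ
  positivity

variable (C) in
theorem cubeIntegral_pos : 0 < C.cubeIntegral := by
  refine intervalIntegral.intervalIntegral_pos_of_pos_on
    (C.continuousOn_cube.intervalIntegrable_of_Icc C.hepsom.le) (fun ξ hξ => ?_) C.hepsom
  have := C.heps.trans hξ.1
  positivity

variable (C) in
theorem tanhDefect_eps_pos : 0 < tanhDefect (C.eps / (2 * C.Tc)) :=
  tanhDefect_pos (div_pos C.heps (mul_pos two_pos (C.T₀_pos.trans C.hT₀₂)))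

variable (C) in
theorem MT_mul_eq : C.MT * (C.eps * C.U₁ * tanhDefect (C.eps / (2 * C.Tc)) * C.cubeIntegral) =
    4 * C.a * C.U₂ * C.Mz ^ 2 := by
  have h : ∫ ξ in C.eps..C.om, (ξ ^ 2 + C.Δ₂ 0 ^ 2) ^ (-(3 : ℝ) / 2) = C.cubeIntegral :=
    C.integral_congr_Icc fun ξ hξ =>
      rpow_neg_three_half (by have := C.pos_of_mem_Icc hξ; positivity)
  rw [C.hMT, h]
  refine div_mul_cancel₀ _ ?_
  have := C.heps
  have := C.hU₁pos
  have := C.cubeIntegral_pos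
  have := C.tanhDefect_eps_pos
  change C.eps * C.U₁ * tanhDefect _ * _ ≠ 0
  positivity

variable (C) in
theorem MT_pos : 0 < C.MT := by
  have := C.heps
  have := C.hU₁pos
  have := C.cubeIntegral_pos
  have := C.tanhDefect_eps_pos
  have := C.U₂_pos
  have := C.Mz_pos
  have := zero_lt_one.trans_le C.one_le_a
  refine pos_of_mul_pos_left (b := C.eps * C.U₁ * tanhDefect (C.eps / (2 * C.Tc)) *
    C.cubeIntegral) ?_ (by positivity)
  rw [C.MT_mul_eq]
  positivity

theorem sum_mul_integral_le {T₁ T₂ x M : ℝ} (hT₁ : T₁ ∈ Icc C.T₀ C.Tc) (hT : T₁ ≤ T₂)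
    (hx : x ∈ Icc C.eps C.om) (hφ : C.IsProfile φ) (hψ : C.IsProfile ψ)
    (hM : ∀ ξ ∈ Icc C.eps C.om, √(ψ ξ) + √(φ ξ) ≤ M) :
    C.gapIntegral T₁ x ψ + C.gapIntegral T₂ x φ ≤
      M * ∫ ξ in C.eps..C.om, C.U x ξ * gapKernel T₁ 0 ξ := by
  have hT0 := C.temp_pos hT₁
  have h0 : C.IsProfile fun _ => 0 := isProfile_const le_rfl
  unfold gapIntegral
  rw [← intervalIntegral.integral_const_mul, ← C.integral_add_of_continuousOn
    (hψ.continuousOn_integrand T₁ hx) (hφ.continuousOn_integrand T₂ hx)]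
  refine C.integral_mono ((hψ.continuousOn_integrand T₁ hx).add
    (hφ.continuousOn_integrand T₂ hx))
    (((C.continuousOn_U_right hx).mul (h0.continuousOn_kernel T₁)).const_mul M) fun ξ hξ => ?_
  have hξ0 := C.pos_of_mem_Icc hξ
  have h1 := gapKernel_anti_snd hT0 hξ0 le_rfl (hψ.nonneg ξ hξ)
  have h2 := (gapKernel_anti_fst hT0 hT (φ ξ) ξ).trans
    (gapKernel_anti_snd hT0 hξ0 le_rfl (hφ.nonneg ξ hξ))
  have hk := gapKernel_nonneg hT0.le 0 ξ
  calc C.U x ξ * (√(ψ ξ) * gapKernel T₁ (ψ ξ) ξ) + C.U x ξ * (√(φ ξ) * gapKernel T₂ (φ ξ) ξ)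
      = C.U x ξ * (√(ψ ξ) * gapKernel T₁ (ψ ξ) ξ + √(φ ξ) * gapKernel T₂ (φ ξ) ξ) := by ring
    _ ≤ C.U x ξ * (√(ψ ξ) * gapKernel T₁ 0 ξ + √(φ ξ) * gapKernel T₁ 0 ξ) := by
        have := (C.U_pos hx hξ).le
        gcongr
    _ = C.U x ξ * ((√(ψ ξ) + √(φ ξ)) * gapKernel T₁ 0 ξ) := by ring
    _ ≤ C.U x ξ * (M * gapKernel T₁ 0 ξ) := by
        have := (C.U_pos hx hξ).le
        gcongr
        exact hM ξ hξ
    _ = _ := by ring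

/-- Up to the factor of one half, the contribution of the variation of the amplitude. -/
theorem amplitude_variation_le {T₁ T₂ x M r d : ℝ} (hT₁ : T₁ ∈ Icc C.T₀ C.Tc) (hT : T₁ ≤ T₂)
    (hx : x ∈ Icc C.eps C.om) (hφ : C.IsProfile φ) (hψ : C.IsProfile ψ) (hM : 0 < M)
    (hd : 0 ≤ d) (hψφ : ∀ ξ ∈ Icc C.eps C.om, ψ ξ = φ ξ + d)
    (hS : ∀ ξ ∈ Icc C.eps C.om, M ≤ r * (√(ψ ξ) + √(φ ξ))) :
    ∫ ξ in C.eps..C.om, C.U x ξ * ((√(ψ ξ) - √(φ ξ)) *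
        (gapKernel T₁ (ψ ξ) ξ + gapKernel T₂ (φ ξ) ξ) / 2) ≤
      d * r / M * ∫ ξ in C.eps..C.om, C.U x ξ * gapKernel T₁ 0 ξ := by
  have hT0 := C.temp_pos hT₁
  have h0 : C.IsProfile fun _ => 0 := isProfile_const le_rfl
  rw [← intervalIntegral.integral_const_mul]
  refine C.integral_mono ((C.continuousOn_U_right hx).mul
    (((hψ.continuousOn_sqrt.sub hφ.continuousOn_sqrt).mul
      ((hψ.continuousOn_kernel T₁).add (hφ.continuousOn_kernel T₂))).div_const 2))
    (((C.continuousOn_U_right hx).mul (h0.continuousOn_kernel T₁)).const_mul _) fun ξ hξ => ?_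
  have hξ0 := C.pos_of_mem_Icc hξ
  have h1 := gapKernel_anti_snd hT0 hξ0 le_rfl (hψ.nonneg ξ hξ)
  have h2 := (gapKernel_anti_fst hT0 hT (φ ξ) ξ).trans
    (gapKernel_anti_snd hT0 hξ0 le_rfl (hφ.nonneg ξ hξ))
  have hk := gapKernel_nonneg hT0.le 0 ξ
  have hU := (C.U_pos hx hξ).le
  have hle : √(φ ξ) ≤ √(ψ ξ) := Real.sqrt_le_sqrt (by rw [hψφ ξ hξ]; linarith)
  have h3 : √(ψ ξ) - √(φ ξ) ≤ d * r / M := by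
    rw [le_div_iff₀ hM]
    have h4 : (√(ψ ξ) - √(φ ξ)) * (√(ψ ξ) + √(φ ξ)) = d := by
      have h5 := Real.sq_sqrt (hψ.nonneg ξ hξ)
      have h6 := Real.sq_sqrt (hφ.nonneg ξ hξ)
      have h7 := hψφ ξ hξ
      nlinarith
    calc (√(ψ ξ) - √(φ ξ)) * M ≤ (√(ψ ξ) - √(φ ξ)) * (r * (√(ψ ξ) + √(φ ξ))) :=
          mul_le_mul_of_nonneg_left (hS ξ hξ) (sub_nonneg.2 hle)
      _ = ((√(ψ ξ) - √(φ ξ)) * (√(ψ ξ) + √(φ ξ))) * r := by ring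
      _ = d * r := by rw [h4]
  calc C.U x ξ * ((√(ψ ξ) - √(φ ξ)) * (gapKernel T₁ (ψ ξ) ξ + gapKernel T₂ (φ ξ) ξ) / 2)
      = C.U x ξ * ((√(ψ ξ) - √(φ ξ)) *
          ((gapKernel T₁ (ψ ξ) ξ + gapKernel T₂ (φ ξ) ξ) / 2)) := by ring
    _ ≤ C.U x ξ * ((√(ψ ξ) - √(φ ξ)) * gapKernel T₁ 0 ξ) := by
        have := sub_nonneg.2 hle
        gcongr
        linarith
    _ ≤ C.U x ξ * (d * r / M * gapKernel T₁ 0 ξ) := by gcongr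
    _ = _ := by ring

/-- The contribution of the variation of the kernel is nonpositive, by the choice of `M_T`. -/
theorem kernel_variation_nonpos {T₁ T₂ x M : ℝ} (hT₁ : T₁ ∈ Icc C.T₀ C.Tc) (hT : T₁ ≤ T₂)
    (hx : x ∈ Icc C.eps C.om) (hφ : C.IsProfile φ) (hψ : C.IsProfile ψ) (hM : 0 < M)
    (hψφ : ∀ ξ ∈ Icc C.eps C.om, ψ ξ = φ ξ + C.MT * (T₂ - T₁))
    (hψΔ : ∀ ξ ∈ Icc C.eps C.om, ψ ξ ≤ C.Δ₂ 0 ^ 2)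
    (hSM : ∀ ξ ∈ Icc C.eps C.om, √(ψ ξ) + √(φ ξ) ≤ M)
    (hS : ∀ ξ ∈ Icc C.eps C.om, M ≤ C.Umax / C.Umin * (√(ψ ξ) + √(φ ξ))) :
    ∫ ξ in C.eps..C.om, C.U x ξ * ((√(ψ ξ) + √(φ ξ)) *
        (gapKernel T₁ (ψ ξ) ξ - gapKernel T₂ (φ ξ) ξ) / 2) ≤ 0 := by
  have hT0 := C.temp_pos hT₁
  have hMT := C.MT_pos
  have hr := zero_lt_one.trans_le C.one_le_ratio
  have ht := C.tanhDefect_eps_pos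
  have hMTeq := C.MT_mul_eq
  have ha := C.ha
  have hr1 := C.one_le_ratio
  set r := C.Umax / C.Umin
  set t := tanhDefect (C.eps / (2 * C.Tc))
  set h := T₂ - T₁ with hh
  have hh0 : 0 ≤ h := sub_nonneg.2 hT
  have hU₁ := C.hU₁pos
  have hU₂ := C.U₂_pos
  have hz := C.Mz_pos
  have he := C.heps
  have hcsq : ContinuousOn (fun ξ : ℝ => 1 / ξ ^ 2) (Icc C.eps C.om) :=
    continuousOn_const.div (by fun_prop) fun ξ hξ => pow_ne_zero 2 (C.pos_of_mem_Icc hξ).ne'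
  have key : ∫ ξ in C.eps..C.om, C.U x ξ * ((√(ψ ξ) + √(φ ξ)) *
        (gapKernel T₁ (ψ ξ) ξ - gapKernel T₂ (φ ξ) ξ) / 2) ≤
      ∫ ξ in C.eps..C.om, (C.U₂ * M * C.Mz ^ 2 * h * (1 / ξ ^ 2) -
        C.U₁ * (M / r) * t * C.MT * h / 4 * (1 / √(ξ ^ 2 + C.Δ₂ 0 ^ 2) ^ 3)) := by
    refine C.integral_mono ((C.continuousOn_U_right hx).mul
      (((hψ.continuousOn_sqrt.add hφ.continuousOn_sqrt).mul
        ((hψ.continuousOn_kernel T₁).sub (hφ.continuousOn_kernel T₂))).div_const 2))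
      ((hcsq.const_mul _).sub (C.continuousOn_cube.const_mul _)) fun ξ hξ => ?_
    have hξ0 := C.pos_of_mem_Icc hξ
    have hφ0 := hφ.nonneg ξ hξ
    have h1 := gapKernel_sub_le_snd hT0 hT₁.2 he hξ.1 hφ0
      (by rw [hψφ ξ hξ]; exact le_add_of_nonneg_right (by positivity)) (hψΔ ξ hξ)
    have h2 := gapKernel_sub_le_fst hT0 hT hξ0 hφ0 (fun z => C.le_Mz (z := z))
    rw [show ψ ξ - φ ξ = C.MT * h by rw [hψφ ξ hξ]; ring] at h1
    rw [← hh] at h2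
    have hS0 : M / r ≤ √(ψ ξ) + √(φ ξ) := (div_le_iff₀' hr).2 (hS ξ hξ)
    have hSM' := hSM ξ hξ
    have hUS1 : C.U₁ * (M / r) ≤ C.U x ξ * (√(ψ ξ) + √(φ ξ)) :=
      mul_le_mul (C.hUlb x hx ξ hξ) hS0 (by positivity) (C.U_pos hx hξ).le
    have hUS2 : C.U x ξ * (√(ψ ξ) + √(φ ξ)) ≤ C.U₂ * M :=
      mul_le_mul (C.hUub x hx ξ hξ) hSM' (by positivity) hU₂.le
    have hUS0 : 0 ≤ C.U x ξ * (√(ψ ξ) + √(φ ξ)) := le_trans (by positivity) hUS1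
    set S := C.U x ξ * (√(ψ ξ) + √(φ ξ))
    calc C.U x ξ * ((√(ψ ξ) + √(φ ξ)) * (gapKernel T₁ (ψ ξ) ξ - gapKernel T₂ (φ ξ) ξ) / 2)
        = S / 2 * ((gapKernel T₁ (ψ ξ) ξ - gapKernel T₁ (φ ξ) ξ) +
            (gapKernel T₁ (φ ξ) ξ - gapKernel T₂ (φ ξ) ξ)) := by ring
      _ ≤ S / 2 * (-(t / (2 * √(ξ ^ 2 + C.Δ₂ 0 ^ 2) ^ 3)) * (C.MT * h) +
            2 * C.Mz ^ 2 / ξ ^ 2 * h) := by gcongr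
      _ = S * (C.Mz ^ 2 * h * (1 / ξ ^ 2)) -
            S * (t * C.MT * h / 4 * (1 / √(ξ ^ 2 + C.Δ₂ 0 ^ 2) ^ 3)) := by ring
      _ ≤ C.U₂ * M * (C.Mz ^ 2 * h * (1 / ξ ^ 2)) -
            C.U₁ * (M / r) * (t * C.MT * h / 4 * (1 / √(ξ ^ 2 + C.Δ₂ 0 ^ 2) ^ 3)) := by
          gcongr
      _ = _ := by ring
  refine key.trans ?_
  rw [C.integral_sub_of_continuousOn (hcsq.const_mul _) (C.continuousOn_cube.const_mul _),
    intervalIntegral.integral_const_mul, intervalIntegral.integral_const_mul]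
  change _ - _ * C.cubeIntegral ≤ 0
  have h1 := integral_one_div_sq_le he C.hepsom.le
  have h2 : C.U₁ * (M / r) * t * C.MT * h / 4 * C.cubeIntegral =
      C.U₂ * M * C.Mz ^ 2 * h * (1 / C.eps) * r := by
    have h3 : C.U₁ * t * C.MT * C.cubeIntegral = 4 * r ^ 2 * C.U₂ * C.Mz ^ 2 / C.eps := by
      rw [eq_div_iff he.ne', ← ha, ← hMTeq]
      ring
    calc C.U₁ * (M / r) * t * C.MT * h / 4 * C.cubeIntegral
        = M / r * h / 4 * (C.U₁ * t * C.MT * C.cubeIntegral) := by ring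
      _ = _ := by rw [h3]; field_simp
  rw [h2, sub_nonpos]
  calc C.U₂ * M * C.Mz ^ 2 * h * ∫ ξ in C.eps..C.om, 1 / ξ ^ 2
      ≤ C.U₂ * M * C.Mz ^ 2 * h * (1 / C.eps) := by gcongr
    _ ≤ _ := le_mul_of_one_le_right (by positivity) hr1

theorem gapIntegral_sq_sub_le (hcond : gapCondition C) {T₁ T₂ x : ℝ}
    (hT₁ : T₁ ∈ Icc C.T₀ C.Tc) (hT : T₁ < T₂) (hx : x ∈ Icc C.eps C.om)
    (hφ : C.IsProfile φ) (hψ : C.IsProfile ψ)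
    (hψφ : ∀ ξ ∈ Icc C.eps C.om, ψ ξ = φ ξ + C.MT * (T₂ - T₁))
    (hψΔ : ∀ ξ ∈ Icc C.eps C.om, ψ ξ ≤ C.Δ₂ 0 ^ 2)
    (hratio : ∀ ξ ∈ Icc C.eps C.om, ∀ η ∈ Icc C.eps C.om, φ ξ ≤ C.a * φ η) :
    C.gapIntegral T₁ x ψ ^ 2 - C.gapIntegral T₂ x φ ^ 2 ≤ C.MT * (T₂ - T₁) := by
  have hT0 := C.temp_pos hT₁
  have hMT := C.MT_pos
  have hr := zero_lt_one.trans_le C.one_le_ratio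
  have hd : 0 < C.MT * (T₂ - T₁) := mul_pos hMT (sub_pos.2 hT)
  have hJ := ratio_mul_sq_integral_le_one hcond hT₁ hx
  obtain ⟨η, hη, hmax⟩ := isCompact_Icc.exists_isMaxOn (nonempty_Icc.2 C.hepsom.le)
    (hψ.continuousOn_sqrt.add hφ.continuousOn_sqrt)
  set M := √(ψ η) + √(φ η) with hMdef
  have hSM : ∀ ξ ∈ Icc C.eps C.om, √(ψ ξ) + √(φ ξ) ≤ M := fun ξ hξ => hmax hξ
  have hM : 0 < M := by
    refine add_pos_of_pos_of_nonneg (Real.sqrt_pos.2 ?_) (Real.sqrt_nonneg _)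
    rw [hψφ η hη]
    exact add_pos_of_nonneg_of_pos (hφ.nonneg η hη) hd
  have hS : ∀ ξ ∈ Icc C.eps C.om, M ≤ C.Umax / C.Umin * (√(ψ ξ) + √(φ ξ)) := fun ξ hξ => by
    rw [mul_add]
    refine add_le_add (sqrt_ratio_sq_le ?_) (sqrt_ratio_sq_le (hratio η hη ξ hξ))
    rw [hψφ η hη, hψφ ξ hξ, mul_add]
    exact add_le_add (hratio η hη ξ hξ) (le_mul_of_one_le_left hd.le C.one_le_a)
  have h1 := sum_mul_integral_le hT₁ hT.le hx hφ hψ hSM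
  have h2 := amplitude_variation_le hT₁ hT.le hx hφ hψ hM hd.le hψφ hS
  have h3 := kernel_variation_nonpos hT₁ hT.le hx hφ hψ hM hψφ hψΔ hSM hS
  have hsum : C.gapIntegral T₁ x ψ - C.gapIntegral T₂ x φ =
      (∫ ξ in C.eps..C.om, C.U x ξ * ((√(ψ ξ) - √(φ ξ)) *
        (gapKernel T₁ (ψ ξ) ξ + gapKernel T₂ (φ ξ) ξ) / 2)) +
      ∫ ξ in C.eps..C.om, C.U x ξ * ((√(ψ ξ) + √(φ ξ)) *
        (gapKernel T₁ (ψ ξ) ξ - gapKernel T₂ (φ ξ) ξ) / 2) := by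
    unfold gapIntegral
    rw [← C.integral_sub_of_continuousOn (hψ.continuousOn_integrand T₁ hx)
      (hφ.continuousOn_integrand T₂ hx)]
    refine Eq.trans ?_ (C.integral_add_of_continuousOn
      ((C.continuousOn_U_right hx).mul
        (((hψ.continuousOn_sqrt.sub hφ.continuousOn_sqrt).mul
        ((hψ.continuousOn_kernel T₁).add (hφ.continuousOn_kernel T₂))).div_const 2))
      ((C.continuousOn_U_right hx).mul
        (((hψ.continuousOn_sqrt.add hφ.continuousOn_sqrt).mul
        ((hψ.continuousOn_kernel T₁).sub (hφ.continuousOn_kernel T₂))).div_const 2)))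
    congr 1
    ext ξ
    ring
  set J := ∫ ξ in C.eps..C.om, C.U x ξ * gapKernel T₁ 0 ξ
  set r := C.Umax / C.Umin
  have hv : 0 ≤ C.gapIntegral T₁ x ψ + C.gapIntegral T₂ x φ :=
    add_nonneg (gapIntegral_nonneg hT0.le hx ψ) (gapIntegral_nonneg (hT0.trans hT).le hx φ)
  have hJ0 : 0 ≤ J := nonneg_of_mul_nonneg_right (hv.trans h1) hM
  calc C.gapIntegral T₁ x ψ ^ 2 - C.gapIntegral T₂ x φ ^ 2
      = (C.gapIntegral T₁ x ψ + C.gapIntegral T₂ x φ) *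
          (C.gapIntegral T₁ x ψ - C.gapIntegral T₂ x φ) := by ring
    _ ≤ (C.gapIntegral T₁ x ψ + C.gapIntegral T₂ x φ) *
          (C.MT * (T₂ - T₁) * r / M * J) := by
        gcongr
        linarith
    _ ≤ M * J * (C.MT * (T₂ - T₁) * r / M * J) := by gcongr
    _ = C.MT * (T₂ - T₁) * (r * J ^ 2) := by field_simp
    _ ≤ C.MT * (T₂ - T₁) * 1 := by gcongr
    _ = _ := mul_one _

end BCSContext

namespace BCSContext

variable (C : BCSContext)

theorem Δ₂_le {T : ℝ} (hT : T ∈ Icc C.T₀ C.Tc) : C.Δ₂ T ≤ C.Δ₂ C.T₀ :=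
  C.hΔ₂anti.antitoneOn ⟨C.T₀_pos.le, C.hT₀₂.le.trans C.hTc₂⟩
    ⟨(C.temp_pos hT).le, hT.2.trans C.hTc₂⟩ hT.1

theorem Δ₂_T₀_lt : C.Δ₂ C.T₀ < C.Δ₂ 0 :=
  C.hΔ₂anti ⟨le_rfl, C.htau₂pos.le⟩ ⟨C.T₀_pos.le, C.hT₀₂.le.trans C.hTc₂⟩ C.T₀_pos

/-- The functions that turn out to constitute the closure of `W`: the requirements defining `W`
with the smoothness weakened to Lipschitz continuity in the temperature. -/
structure Admissible (f : ℝ → ℝ → ℝ) : Prop where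
  cont : ContinuousOn (fun p : ℝ × ℝ => f p.1 p.2) C.Dset
  nonneg : ∀ T ∈ Icc C.T₀ C.Tc, ∀ x ∈ Icc C.eps C.om, 0 ≤ f T x
  le_Δ₂ : ∀ T ∈ Icc C.T₀ C.Tc, ∀ x ∈ Icc C.eps C.om, f T x ≤ C.Δ₂ T ^ 2
  zero : ∀ x ∈ Icc C.eps C.om, f C.Tc x = 0
  ratio : ∀ T ∈ Icc C.T₀ C.Tc, ∀ x ∈ Icc C.eps C.om, ∀ x₁ ∈ Icc C.eps C.om,
    f T x ≤ C.a * f T x₁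
  anti : ∀ x ∈ Icc C.eps C.om, AntitoneOn (fun T => f T x) (Icc C.T₀ C.Tc)
  lip : ∀ T₁ ∈ Icc C.T₀ C.Tc, ∀ T₂ ∈ Icc C.T₀ C.Tc, T₁ ≤ T₂ → ∀ x ∈ Icc C.eps C.om,
    f T₁ x ≤ f T₂ x + C.MT * (T₂ - T₁)

variable {C} {f g : ℝ → ℝ → ℝ}

theorem Admissible.isProfile (hf : C.Admissible f) {T : ℝ} (hT : T ∈ Icc C.T₀ C.Tc) :
    C.IsProfile (f T) where
  cont := hf.cont.comp (f := fun ξ => (T, ξ)) (by fun_prop) fun _ hξ => ⟨hT, hξ⟩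
  nonneg := hf.nonneg T hT

theorem Admissible.congr (hf : C.Admissible f)
    (h : ∀ T ∈ Icc C.T₀ C.Tc, ∀ x ∈ Icc C.eps C.om, g T x = f T x) : C.Admissible g where
  cont := hf.cont.congr fun p hp => h p.1 hp.1 p.2 hp.2
  nonneg T hT x hx := by rw [h T hT x hx]; exact hf.nonneg T hT x hx
  le_Δ₂ T hT x hx := by rw [h T hT x hx]; exact hf.le_Δ₂ T hT x hx
  zero x hx := by rw [h _ (right_mem_Icc.2 C.hT₀₂.le) x hx]; exact hf.zero x hx
  ratio T hT x hx x₁ hx₁ := by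
    rw [h T hT x hx, h T hT x₁ hx₁]; exact hf.ratio T hT x hx x₁ hx₁
  anti x hx := (hf.anti x hx).congr fun T hT => (h T hT x hx).symm
  lip T₁ hT₁ T₂ hT₂ hT x hx := by
    rw [h T₁ hT₁ x hx, h T₂ hT₂ x hx]; exact hf.lip T₁ hT₁ T₂ hT₂ hT x hx

theorem Admissible.opA_eq (hf : C.Admissible f) {T : ℝ} (hT : T ∈ Icc C.T₀ C.Tc) (x : ℝ) :
    opA C f T x = C.gapIntegral T x (f T) ^ 2 :=
  C.opA_eq (hf.nonneg T hT) x

theorem Admissible.opA_anti (hf : C.Admissible f) {x : ℝ} (hx : x ∈ Icc C.eps C.om) :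
    AntitoneOn (fun T => opA C f T x) (Icc C.T₀ C.Tc) := fun T₁ hT₁ T₂ hT₂ hT => by
  dsimp only
  rw [hf.opA_eq hT₁, hf.opA_eq hT₂]
  exact pow_le_pow_left₀ (gapIntegral_nonneg (C.temp_pos hT₂).le hx _)
    (gapIntegral_mono (C.temp_pos hT₁) hT hx (hf.isProfile hT₂) (hf.isProfile hT₁)
      fun ξ hξ => hf.anti ξ hξ hT₁ hT₂ hT) 2

theorem Admissible.opA_lip_of_close (hcond : gapCondition C) (hf : C.Admissible f)
    {T₁ T₂ x : ℝ} (hT₁ : T₁ ∈ Icc C.T₀ C.Tc) (hT₂ : T₂ ∈ Icc C.T₀ C.Tc) (hT : T₁ ≤ T₂)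
    (hclose : C.Δ₂ C.T₀ ^ 2 + C.MT * (T₂ - T₁) ≤ C.Δ₂ 0 ^ 2) (hx : x ∈ Icc C.eps C.om) :
    opA C f T₁ x ≤ opA C f T₂ x + C.MT * (T₂ - T₁) := by
  rcases hT.eq_or_lt with rfl | hlt
  · simp
  have hd : 0 ≤ C.MT * (T₂ - T₁) := mul_nonneg C.MT_pos.le (sub_nonneg.2 hT)
  have hφ := hf.isProfile hT₂
  have hψ : C.IsProfile fun ξ => f T₂ ξ + C.MT * (T₂ - T₁) :=
    ⟨hφ.cont.add continuousOn_const, fun ξ hξ => add_nonneg (hφ.nonneg ξ hξ) hd⟩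
  have h1 := gapIntegral_sq_sub_le hcond hT₁ hlt hx hφ hψ (fun _ _ => rfl)
    (fun ξ hξ => le_trans (by
      have h2 := hf.le_Δ₂ T₂ hT₂ ξ hξ
      have h3 := pow_le_pow_left₀ (C.hΔ₂nonneg T₂) (C.Δ₂_le hT₂) 2
      linarith) hclose) (hf.ratio T₂ hT₂)
  have h4 := pow_le_pow_left₀ (gapIntegral_nonneg (C.temp_pos hT₁).le hx _)
    (gapIntegral_mono (C.temp_pos hT₁) le_rfl hx (hf.isProfile hT₁) hψ
      fun ξ hξ => hf.lip T₁ hT₁ T₂ hT₂ hT ξ hξ) 2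
  rw [hf.opA_eq hT₁, hf.opA_eq hT₂]
  linarith

theorem Admissible.opA_lip (hcond : gapCondition C) (hf : C.Admissible f) {x : ℝ}
    (hx : x ∈ Icc C.eps C.om) {T₁ T₂ : ℝ} (hT₁ : T₁ ∈ Icc C.T₀ C.Tc)
    (hT₂ : T₂ ∈ Icc C.T₀ C.Tc) (hT : T₁ ≤ T₂) :
    opA C f T₁ x ≤ opA C f T₂ x + C.MT * (T₂ - T₁) := by
  have hMT := C.MT_pos
  have hΔ : 0 < C.Δ₂ 0 ^ 2 - C.Δ₂ C.T₀ ^ 2 :=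
    sub_pos.2 (pow_lt_pow_left₀ C.Δ₂_T₀_lt (C.hΔ₂nonneg _) two_ne_zero)
  obtain ⟨s, hs0, hs⟩ : ∃ s : ℝ, 0 < s ∧ C.MT * s = C.Δ₂ 0 ^ 2 - C.Δ₂ C.T₀ ^ 2 :=
    ⟨_, div_pos hΔ hMT, mul_div_cancel₀ _ hMT.ne'⟩
  obtain ⟨n, hn⟩ := exists_nat_ge ((T₂ - T₁) / s)
  rw [div_le_iff₀ hs0] at hn
  induction n generalizing T₁ with
  | zero =>
    have : T₁ = T₂ := le_antisymm hT (by simpa using hn)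
    simp [this]
  | succ n ih =>
    by_cases hclose : T₂ - T₁ ≤ s
    · refine hf.opA_lip_of_close hcond hT₁ hT₂ hT ?_ hx
      linarith [mul_le_mul_of_nonneg_left hclose hMT.le]
    · push Not at hclose
      have hT' : T₁ + s ∈ Icc C.T₀ C.Tc := ⟨by linarith [hT₁.1], by linarith [hT₂.2]⟩
      have h1 := hf.opA_lip_of_close hcond hT₁ hT' (by linarith) (by linarith) hx
      have h2 := ih hT' (by linarith) (by push_cast at hn; linarith)
      linarith

theorem Admissible.abs_opA_sub_le (hcond : gapCondition C) (hf : C.Admissible f) {x : ℝ}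
    (hx : x ∈ Icc C.eps C.om) {T₁ T₂ : ℝ} (hT₁ : T₁ ∈ Icc C.T₀ C.Tc)
    (hT₂ : T₂ ∈ Icc C.T₀ C.Tc) : |opA C f T₁ x - opA C f T₂ x| ≤ C.MT * |T₁ - T₂| := by
  wlog hT : T₁ ≤ T₂ generalizing T₁ T₂
  · rw [abs_sub_comm, abs_sub_comm T₁]
    exact this hT₂ hT₁ (le_of_not_ge hT)
  have h1 := hf.opA_lip hcond hx hT₁ hT₂ hT
  have h2 := hf.opA_anti hx hT₁ hT₂ hT
  dsimp only at h2
  rw [abs_of_nonneg (by linarith), abs_of_nonpos (by linarith)]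
  linarith

variable (C) in
/-- A bound for `gapIntegral`. -/
def gapBound : ℝ := C.U₂ * (C.om - C.eps)

variable (C) in
theorem gapBound_pos : 0 < C.gapBound := mul_pos C.U₂_pos (sub_pos.2 C.hepsom)

theorem Admissible.abs_opA_le (hf : C.Admissible f) {T x : ℝ} (hT : T ∈ Icc C.T₀ C.Tc)
    (hx : x ∈ Icc C.eps C.om) : |opA C f T x| ≤ C.gapBound ^ 2 := by
  rw [hf.opA_eq hT, abs_of_nonneg (sq_nonneg _)]
  exact pow_le_pow_left₀ (gapIntegral_nonneg (C.temp_pos hT).le hx _)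
    (gapIntegral_le (C.temp_pos hT).le hx (hf.isProfile hT)) 2

theorem abs_sq_sub_sq_le {u v B d : ℝ} (hu : 0 ≤ u) (hv : 0 ≤ v) (huB : u ≤ B) (hvB : v ≤ B)
    (h : |u - v| ≤ d) : |u ^ 2 - v ^ 2| ≤ 2 * B * d := by
  rw [sq_sub_sq, abs_mul, abs_of_nonneg (add_nonneg hu hv)]
  exact mul_le_mul (by linarith) h (abs_nonneg _) (by linarith)

theorem exists_opA_modulus (hcond : gapCondition C) {δ : ℝ} (hδ : 0 < δ) :
    ∃ η > 0, ∀ f, C.Admissible f → ∀ p ∈ C.Dset, ∀ q ∈ C.Dset, dist p q < η →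
      |opA C f p.1 p.2 - opA C f q.1 q.2| < δ := by
  have hB := C.gapBound_pos
  have hL := sub_pos.2 C.hepsom
  have hMT := C.MT_pos
  obtain ⟨r, hr, hrδ⟩ : ∃ r > 0, 2 * C.gapBound * (r * (C.om - C.eps)) = δ / 2 :=
    ⟨δ / 2 / (2 * C.gapBound * (C.om - C.eps)), by positivity, by field_simp⟩
  obtain ⟨η₁, hη₁, hU⟩ := Metric.uniformContinuousOn_iff.1
    ((isCompact_Icc.prod isCompact_Icc).uniformContinuousOn_of_continuous C.continuousOn_U) r hr
  refine ⟨min η₁ (δ / 2 / C.MT), by positivity, fun f hf p hp q hq hpq => ?_⟩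
  rw [Prod.dist_eq, max_lt_iff, lt_min_iff, lt_min_iff] at hpq
  have h1 := hf.abs_opA_sub_le hcond hp.2 hp.1 hq.1
  have h2 : C.MT * |p.1 - q.1| < δ / 2 := (lt_div_iff₀' hMT).1 hpq.1.2
  have hT0 := (C.temp_pos hq.1).le
  have hprof := hf.isProfile hq.1
  have h3 : |opA C f q.1 p.2 - opA C f q.1 q.2| ≤ δ / 2 := by
    rw [hf.opA_eq hq.1, hf.opA_eq hq.1, ← hrδ]
    refine abs_sq_sub_sq_le (gapIntegral_nonneg hT0 hp.2 _) (gapIntegral_nonneg hT0 hq.2 _)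
      (gapIntegral_le hT0 hp.2 hprof) (gapIntegral_le hT0 hq.2 hprof)
      (abs_gapIntegral_sub_le_of_abs_U_sub_le hT0 hp.2 hq.2 hprof fun ξ hξ => ?_)
    refine (hU (p.2, ξ) ⟨hp.2, hξ⟩ (q.2, ξ) ⟨hq.2, hξ⟩ ?_).le
    rw [Prod.dist_eq, dist_self]
    exact max_lt hpq.2.1 hη₁
  calc |opA C f p.1 p.2 - opA C f q.1 q.2|
      ≤ |opA C f p.1 p.2 - opA C f q.1 p.2| + |opA C f q.1 p.2 - opA C f q.1 q.2| :=
        abs_sub_le _ _ _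
    _ < δ := by linarith

theorem Admissible.opA (hcond : gapCondition C) (hf : C.Admissible f) :
    C.Admissible (opA C f) where
  cont := by
    rw [Metric.continuousOn_iff]
    intro p hp δ hδ
    obtain ⟨η, hη, h⟩ := exists_opA_modulus hcond hδ
    exact ⟨η, hη, fun q hq hqp => h f hf q hq p hp hqp⟩
  nonneg _ _ _ _ := sq_nonneg _
  le_Δ₂ T hT x hx := by
    rw [hf.opA_eq hT]
    exact pow_le_pow_left₀ (gapIntegral_nonneg (C.temp_pos hT).le hx _)
      (gapIntegral_le_Δ₂ hT hx (hf.isProfile hT) (hf.le_Δ₂ T hT)) 2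
  zero x hx := by
    rw [hf.opA_eq (right_mem_Icc.2 C.hT₀₂.le), gapIntegral_of_eq_zero hf.zero]
    simp
  ratio T hT x hx x₁ hx₁ := by
    rw [hf.opA_eq hT, hf.opA_eq hT, C.ha, ← mul_pow]
    exact pow_le_pow_left₀ (gapIntegral_nonneg (C.temp_pos hT).le hx _)
      (gapIntegral_le_ratio_mul (C.temp_pos hT).le hx hx₁ (hf.isProfile hT)) 2
  anti _ hx := hf.opA_anti hx
  lip _ hT₁ _ hT₂ hT _ hx := hf.opA_lip hcond hx hT₁ hT₂ hT

theorem Admissible.abs_opA_sub_opA_le (hf : C.Admissible f) (hg : C.Admissible g) {d : ℝ}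
    (h : ∀ T ∈ Icc C.T₀ C.Tc, ∀ x ∈ Icc C.eps C.om, |f T x - g T x| ≤ d) {T x : ℝ}
    (hT : T ∈ Icc C.T₀ C.Tc) (hx : x ∈ Icc C.eps C.om) :
    |_root_.opA C f T x - _root_.opA C g T x| ≤
      2 * C.gapBound * (C.U₂ * (√d / C.eps) * (C.om - C.eps)) := by
  have hT0 := C.temp_pos hT
  have hfp := hf.isProfile hT
  have hgp := hg.isProfile hT
  rw [hf.opA_eq hT, hg.opA_eq hT]
  exact abs_sq_sub_sq_le (gapIntegral_nonneg hT0.le hx _) (gapIntegral_nonneg hT0.le hx _)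
    (gapIntegral_le hT0.le hx hfp) (gapIntegral_le hT0.le hx hgp)
    (abs_gapIntegral_sub_le hT0 hx hfp hgp (h T hT))

theorem Admissible.eq_zero_of_eq_opA (hcond : gapCondition C) (hf : C.Admissible f)
    (hfix : ∀ T ∈ Icc C.T₀ C.Tc, ∀ x ∈ Icc C.eps C.om, f T x = _root_.opA C f T x) {T x : ℝ}
    (hT : T ∈ Icc C.T₀ C.Tc) (hx : x ∈ Icc C.eps C.om) : f T x = 0 := by
  by_contra hne
  have hT0 := C.temp_pos hT
  have hprof := hf.isProfile hT
  obtain ⟨y, hy, hmax⟩ := isCompact_Icc.exists_isMaxOn (nonempty_Icc.2 C.hepsom.le) hprof.cont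
  have hpos : 0 < f T y :=
    ((hprof.nonneg x hx).lt_of_ne (Ne.symm hne)).trans_le (hmax hx)
  have hu : 0 < √(f T y) := Real.sqrt_pos.2 hpos
  have h0 : C.IsProfile fun _ => 0 := isProfile_const le_rfl
  have hval : √(f T y) = C.gapIntegral T y (f T) := by
    conv_lhs => rw [hfix T hT y hy, hf.opA_eq hT]
    exact Real.sqrt_sq (gapIntegral_nonneg hT0.le hy _)
  have hlt : C.gapIntegral T y (f T) <
      ∫ ξ in C.eps..C.om, √(f T y) * (C.U y ξ * gapKernel T 0 ξ) := by
    refine intervalIntegral.integral_lt_integral_of_continuousOn_of_le_of_exists_lt C.hepsom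
      (hprof.continuousOn_integrand T hy)
      (((C.continuousOn_U_right hy).mul (h0.continuousOn_kernel T)).const_mul _)
      (fun ξ hξ => ?_) ⟨y, hy, ?_⟩
    · have hξ' := Ioc_subset_Icc_self hξ
      have hU := (C.U_pos hy hξ').le
      have hk := gapKernel_anti_snd hT0 (C.pos_of_mem_Icc hξ') le_rfl (hprof.nonneg ξ hξ')
      have hs := Real.sqrt_le_sqrt (hmax hξ')
      rw [mul_left_comm (√(f T y))]
      exact mul_le_mul_of_nonneg_left (mul_le_mul hs hk (gapKernel_nonneg hT0.le _ _) hu.le) hU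
    · rw [mul_left_comm (√(f T y))]
      exact mul_lt_mul_of_pos_left (mul_lt_mul_of_pos_left
        (gapKernel_lt_snd hT0 (C.pos_of_mem_Icc hy) hpos) hu) (C.U_pos hy hy)
  rw [intervalIntegral.integral_const_mul, ← hval] at hlt
  have hJ := ratio_mul_sq_integral_le_one hcond hT hy
  have hr := C.one_le_ratio
  set J := ∫ ξ in C.eps..C.om, C.U y ξ * gapKernel T 0 ξ
  have hJ1 : 1 < J := by
    by_contra hJ1
    push Not at hJ1
    exact absurd (mul_le_of_le_one_right hu.le hJ1) hlt.not_ge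
  nlinarith

end BCSContext

theorem antitoneOn_of_derivWithin_Icc_nonpos {h : ℝ → ℝ} {a b : ℝ}
    (hd : DifferentiableOn ℝ h (Icc a b)) (h' : ∀ t ∈ Icc a b, derivWithin h (Icc a b) t ≤ 0) :
    AntitoneOn h (Icc a b) := by
  refine antitoneOn_of_deriv_nonpos (convex_Icc a b) hd.continuousOn
    (hd.mono interior_subset) fun t ht => ?_
  rw [← derivWithin_of_mem_nhds (mem_interior_iff_mem_nhds.1 ht)]
  exact h' t (interior_subset ht)

theorem le_add_mul_of_neg_derivWithin_Icc_le {h : ℝ → ℝ} {a b M : ℝ}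
    (hd : DifferentiableOn ℝ h (Icc a b)) (h' : ∀ t ∈ Icc a b, -derivWithin h (Icc a b) t ≤ M)
    {t₁ t₂ : ℝ} (ht₁ : t₁ ∈ Icc a b) (ht₂ : t₂ ∈ Icc a b) (ht : t₁ ≤ t₂) :
    h t₁ ≤ h t₂ + M * (t₂ - t₁) := by
  rcases ht.eq_or_lt with rfl | hlt
  · simp
  have hu := uniqueDiffOn_Icc (ht₁.1.trans_lt (hlt.trans_le ht₂.2))
  have key := antitoneOn_of_derivWithin_Icc_nonpos (h := fun t => -h t - M * t)
    (hd.neg.sub (differentiableOn_id.const_mul M)) fun t ht => by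
      have h1 := ((hd t ht).hasDerivWithinAt.neg.sub
        ((hasDerivWithinAt_id t _).const_mul M)).derivWithin (hu t ht)
      have h2 := h' t ht
      simp only [mul_one] at h1
      refine (le_of_eq h1).trans (by linarith)
  have := key ht₁ ht₂ ht
  dsimp only at this
  linarith

namespace BCSContext

variable {C : BCSContext} {f g : ℝ → ℝ → ℝ}

theorem extFun_of_mem (F : C(↥C.Dset, ℝ)) {T x : ℝ} (hT : T ∈ Icc C.T₀ C.Tc)
    (hx : x ∈ Icc C.eps C.om) : extFun C F T x = F ⟨(T, x), hT, hx⟩ :=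
  dif_pos (show (T, x) ∈ C.Dset from ⟨hT, hx⟩)

theorem continuousOn_extFun (F : C(↥C.Dset, ℝ)) :
    ContinuousOn (fun p : ℝ × ℝ => extFun C F p.1 p.2) C.Dset := by
  rw [continuousOn_iff_continuous_domRestrict]
  exact F.continuous.congr fun p => (extFun_of_mem F p.2.1 p.2.2).symm

theorem tendsto_extFun {h : ℕ → C(↥C.Dset, ℝ)} {F : C(↥C.Dset, ℝ)}
    (hF : Tendsto h atTop (𝓝 F)) {T x : ℝ} (hT : T ∈ Icc C.T₀ C.Tc)
    (hx : x ∈ Icc C.eps C.om) :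
    Tendsto (fun n => extFun C (h n) T x) atTop (𝓝 (extFun C F T x)) := by
  simp only [extFun_of_mem _ hT hx]
  exact ((continuous_eval_const _).tendsto F).comp hF

theorem isClosed_setOf_admissible :
    IsClosed {F : C(↥C.Dset, ℝ) | C.Admissible (extFun C F)} := by
  refine IsSeqClosed.isClosed fun h F hh hF => ?_
  have lim := fun {T x} => tendsto_extFun hF (T := T) (x := x)
  exact
    { cont := continuousOn_extFun F
      nonneg := fun T hT x hx => ge_of_tendsto' (lim hT hx) fun n => (hh n).nonneg T hT x hx
      le_Δ₂ := fun T hT x hx => le_of_tendsto' (lim hT hx) fun n => (hh n).le_Δ₂ T hT x hx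
      zero := fun x hx => tendsto_nhds_unique (lim (right_mem_Icc.2 C.hT₀₂.le) hx) <|
        tendsto_const_nhds.congr fun n => ((hh n).zero x hx).symm
      ratio := fun T hT x hx x₁ hx₁ => le_of_tendsto_of_tendsto' (lim hT hx)
        ((lim hT hx₁).const_mul _) fun n => (hh n).ratio T hT x hx x₁ hx₁
      anti := fun x hx T₁ hT₁ T₂ hT₂ hT => le_of_tendsto_of_tendsto' (lim hT₂ hx) (lim hT₁ hx)
        fun n => (hh n).anti x hx hT₁ hT₂ hT
      lip := fun T₁ hT₁ T₂ hT₂ hT x hx => le_of_tendsto_of_tendsto' (lim hT₁ hx)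
        ((lim hT₂ hx).add_const _) fun n => (hh n).lip T₁ hT₁ T₂ hT₂ hT x hx }

theorem admissible_of_memW (hf : memW C f) : C.Admissible f := by
  obtain ⟨hsm, hb, hz, hr, -, hneg, hM⟩ := hf
  have hd : ∀ x ∈ Icc C.eps C.om, DifferentiableOn ℝ (fun T => f T x) (Icc C.T₀ C.Tc) :=
    fun x hx => (hsm.differentiableOn two_ne_zero).comp (f := fun T => (T, x))
      (by fun_prop) fun T hT => ⟨hT, hx⟩
  exact
    { cont := hsm.continuousOn
      nonneg := fun T hT x hx => (sq_nonneg _).trans (hb T hT x hx).1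
      le_Δ₂ := fun T hT x hx => (hb T hT x hx).2
      zero := hz
      ratio := fun T hT x hx x₁ hx₁ => by
        rcases hT.2.eq_or_lt with rfl | hlt
        · rw [hz x hx, hz x₁ hx₁, mul_zero]
        · exact hr T ⟨hT.1, hlt⟩ x hx x₁ hx₁
      anti := fun x hx =>
        antitoneOn_of_derivWithin_Icc_nonpos (hd x hx) fun T hT => (hneg T hT x hx).le
      lip := fun T₁ hT₁ T₂ hT₂ hT x hx =>
        le_add_mul_of_neg_derivWithin_Icc_le (hd x hx) (fun T hT => hM T hT x hx) hT₁ hT₂ hT }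

theorem admissible_of_mem_closure {F : C(↥C.Dset, ℝ)} (hF : F ∈ closure (WSet C)) :
    C.Admissible (extFun C F) := by
  refine closure_minimal ?_ isClosed_setOf_admissible hF
  rintro F ⟨f, hf, hFf⟩
  exact (admissible_of_memW hf).congr fun T hT x hx => by rw [extFun_of_mem F hT hx, hFf]

/-- A multiple of `Tc - T` lies below both envelopes defining `W`. -/
theorem exists_pos_mul_le_Δ₂_sq : ∃ c > 0, c ≤ C.MT ∧
    ∀ T ∈ Icc C.T₀ C.Tc, c * (C.Tc - T) ≤ C.Δ₂ T ^ 2 := by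
  have hτ := C.htau₂pos
  have hε := C.heps
  have hT₀ := C.T₀_pos
  have hMT := C.MT_pos
  set k : ℝ := 1 / (2 * C.tau₂ ^ 2 * Real.cosh (C.om / (2 * C.T₀)) ^ 2) with hk
  have hk0 : 0 < k := by have := Real.cosh_pos (C.om / (2 * C.T₀)); positivity
  refine ⟨min C.MT (k * (2 * C.eps ^ 3)), by positivity, min_le_left _ _, fun T hT => ?_⟩
  have hT0 := C.temp_pos hT
  have hTτ : T ≤ C.tau₂ := hT.2.trans C.hTc₂
  set S := C.Δ₂ T ^ 2 with hS
  have hS0 : 0 ≤ S := sq_nonneg _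
  have h0 : C.IsProfile fun _ => 0 := isProfile_const le_rfl
  have hSp : C.IsProfile fun _ => S := isProfile_const hS0
  have hlow : ∀ ξ ∈ Icc C.eps C.om,
      k * (C.tau₂ - T) + gapKernel C.tau₂ 0 ξ ≤ gapKernel T 0 ξ := fun ξ hξ => by
    have hξ0 := C.pos_of_mem_Icc hξ
    have hanti : AntitoneOn (fun t => gapKernel t 0 ξ + k * t) (Icc T C.tau₂) := by
      have hder : ∀ t ∈ Icc T C.tau₂, HasDerivAt (fun t => gapKernel t 0 ξ + k * t) _ t :=
        fun t ht => (hasDerivAt_gapKernel_fst (hT0.trans_le ht.1)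
          (by positivity : 0 < ξ ^ 2 + 0)).add ((hasDerivAt_id t).const_mul k)
      refine antitoneOn_of_hasDerivWithinAt_nonpos (convex_Icc _ _)
        (fun t ht => (hder t ht).continuousAt.continuousWithinAt)
        (fun t ht => (hder t (interior_subset ht)).hasDerivWithinAt) fun t ht => ?_
      have ht' := interior_subset ht
      have ht0 := hT0.trans_le ht'.1
      rw [add_zero, Real.sqrt_sq hξ0.le]
      have hc : Real.cosh (ξ / (2 * t)) ≤ Real.cosh (C.om / (2 * C.T₀)) := by
        rw [Real.cosh_le_cosh, abs_of_pos (by positivity),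
          abs_of_pos (div_pos (C.heps.trans C.hepsom) (by positivity))]
        exact div_le_div₀ (hξ0.le.trans hξ.2) hξ.2 (by positivity) (by linarith [hT.1, ht'.1])
      have hcp := Real.cosh_pos (ξ / (2 * t))
      have e : 2 / ξ ^ 2 * (ξ / (2 * t) / Real.cosh (ξ / (2 * t))) ^ 2 =
          1 / (2 * t ^ 2 * Real.cosh (ξ / (2 * t)) ^ 2) := by field_simp
      have : k ≤ 1 / (2 * t ^ 2 * Real.cosh (ξ / (2 * t)) ^ 2) := by
        rw [hk]
        have := ht'.2
        gcongr
      rw [e]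
      linarith
    have := hanti (left_mem_Icc.2 hTτ) (right_mem_Icc.2 hTτ) hTτ
    dsimp only at this
    linarith
  have hup : ∀ ξ ∈ Icc C.eps C.om,
      gapKernel T 0 ξ ≤ S / (2 * C.eps ^ 3) + gapKernel T S ξ := fun ξ hξ => by
    have hξ0 := C.pos_of_mem_Icc hξ
    have hmono : MonotoneOn (fun s => gapKernel T s ξ + s / (2 * C.eps ^ 3)) (Icc 0 S) := by
      have hder : ∀ s ∈ Icc 0 S,
          HasDerivAt (fun s => gapKernel T s ξ + s / (2 * C.eps ^ 3)) _ s := fun s hs =>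
        (hasDerivAt_gapKernel_snd hT0 (by have := hs.1; positivity)).add
          ((hasDerivAt_id s).div_const _)
      refine monotoneOn_of_hasDerivWithinAt_nonneg (convex_Icc _ _)
        (fun t ht => (hder t ht).continuousAt.continuousWithinAt)
        (fun t ht => (hder t (interior_subset ht)).hasDerivWithinAt) fun s hs => ?_
      have hs' := interior_subset hs
      have hr : C.eps ≤ √(ξ ^ 2 + s) :=
        hξ.1.trans (Real.le_sqrt_of_sq_le (by linarith [hs'.1]))
      have hdef : tanhDefect (√(ξ ^ 2 + s) / (2 * T)) ≤ 1 := by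
        have : 0 ≤ √(ξ ^ 2 + s) / (2 * T) / Real.cosh (√(ξ ^ 2 + s) / (2 * T)) ^ 2 := by
          positivity
        have := (Real.tanh_lt_one (√(ξ ^ 2 + s) / (2 * T))).le
        rw [tanhDefect]; linarith
      have : tanhDefect (√(ξ ^ 2 + s) / (2 * T)) / (2 * √(ξ ^ 2 + s) ^ 3) ≤
          1 / (2 * C.eps ^ 3) := by gcongr
      linarith
    have := hmono (left_mem_Icc.2 hS0) (right_mem_Icc.2 hS0) hS0
    dsimp only at this
    rw [zero_div] at this
    linarith
  have e₁ : (∫ ξ in C.eps..C.om, gapKernel C.tau₂ 0 ξ) =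
      ∫ ξ in C.eps..C.om, gapKernel T S ξ := by
    refine mul_left_cancel₀ C.U₂_pos.ne' (Eq.trans ?_ (C.hΔ₂eq T ⟨hT0, hTτ⟩).symm)
    rw [C.htau₂]
    exact congrArg _ (C.integral_congr_Icc fun ξ hξ => gapKernel_zero (C.pos_of_mem_Icc hξ).le)
  have h1 := C.integral_mono (f := fun ξ => k * (C.tau₂ - T) + gapKernel C.tau₂ 0 ξ)
    (g := fun ξ => S / (2 * C.eps ^ 3) + gapKernel T S ξ)
    (continuousOn_const.add (h0.continuousOn_kernel C.tau₂))
    (continuousOn_const.add (hSp.continuousOn_kernel T))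
    fun ξ hξ => (hlow ξ hξ).trans (hup ξ hξ)
  rw [C.integral_add_of_continuousOn continuousOn_const (h0.continuousOn_kernel C.tau₂),
    C.integral_add_of_continuousOn continuousOn_const (hSp.continuousOn_kernel T), e₁,
    intervalIntegral.integral_const, intervalIntegral.integral_const, smul_eq_mul,
    smul_eq_mul] at h1
  have h2 : k * (C.tau₂ - T) ≤ S / (2 * C.eps ^ 3) :=
    le_of_mul_le_mul_left (by linarith) (sub_pos.2 C.hepsom)
  rw [le_div_iff₀ (by positivity)] at h2
  calc min C.MT (k * (2 * C.eps ^ 3)) * (C.Tc - T)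
      ≤ k * (2 * C.eps ^ 3) * (C.tau₂ - T) := by
        refine mul_le_mul (min_le_right _ _) ?_ ?_ ?_
        · linarith [C.hTc₂]
        · linarith [hT.2]
        · positivity
    _ ≤ S := by linarith

end BCSContext

theorem integral_normed_mul_mono (φ : ContDiffBump (0 : ℝ × ℝ)) {u v : ℝ × ℝ → ℝ}
    (hu : Continuous u) (hv : Continuous v) (h : ∀ y ∈ Metric.ball 0 φ.rOut, u y ≤ v y) :
    ∫ y, φ.normed volume y * u y ≤ ∫ y, φ.normed volume y * v y := by
  have hint : ∀ w : ℝ × ℝ → ℝ, Continuous w → Integrable fun y => φ.normed volume y * w y :=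
    fun w hw => (φ.continuous_normed.mul hw).integrable_of_hasCompactSupport
      φ.hasCompactSupport_normed.mul_right
  refine integral_mono (hint u hu) (hint v hv) fun y => ?_
  by_cases hy : y ∈ Metric.ball 0 φ.rOut
  · exact mul_le_mul_of_nonneg_left (h y hy) (φ.nonneg_normed y)
  · have : φ.normed volume y = 0 := by
      rwa [← φ.support_normed_eq (μ := volume), Function.notMem_support] at hy
    simp [this]

theorem integral_normed_mul_const (φ : ContDiffBump (0 : ℝ × ℝ)) (c : ℝ) :
    ∫ y, φ.normed volume y * c = c := by
  rw [integral_mul_const, φ.integral_normed, one_mul]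

namespace BCSContext

variable {C : BCSContext} {f : ℝ → ℝ → ℝ}

variable (C) in
/-- Extension of a function on `D` to the plane, constant along the exterior normals. -/
def clampExt (f : ℝ → ℝ → ℝ) (T x : ℝ) : ℝ :=
  f (projIcc C.T₀ C.Tc C.hT₀₂.le T) (projIcc C.eps C.om C.hepsom.le x)

theorem clampExt_of_mem {T x : ℝ} (hT : T ∈ Icc C.T₀ C.Tc) (hx : x ∈ Icc C.eps C.om) :
    C.clampExt f T x = f T x := by
  rw [clampExt, projIcc_of_mem _ hT, projIcc_of_mem _ hx]

theorem Admissible.continuous_clampExt (hf : C.Admissible f) :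
    Continuous fun p : ℝ × ℝ => C.clampExt f p.1 p.2 :=
  hf.cont.comp_continuous (f := fun p : ℝ × ℝ =>
      ((projIcc C.T₀ C.Tc C.hT₀₂.le p.1 : ℝ), (projIcc C.eps C.om C.hepsom.le p.2 : ℝ)))
    ((continuous_subtype_val.comp (continuous_projIcc.comp continuous_fst)).prodMk
      (continuous_subtype_val.comp (continuous_projIcc.comp continuous_snd))) fun _ => ⟨Subtype.prop _, Subtype.prop _⟩

theorem Admissible.clampExt_nonneg (hf : C.Admissible f) (T x : ℝ) : 0 ≤ C.clampExt f T x :=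
  hf.nonneg _ (Subtype.prop _) _ (Subtype.prop _)

theorem Admissible.clampExt_ratio (hf : C.Admissible f) (T x x₁ : ℝ) :
    C.clampExt f T x ≤ C.a * C.clampExt f T x₁ :=
  hf.ratio _ (Subtype.prop _) _ (Subtype.prop _) _ (Subtype.prop _)

theorem Admissible.clampExt_anti (hf : C.Admissible f) {T₁ T₂ : ℝ} (hT : T₁ ≤ T₂) (x : ℝ) :
    C.clampExt f T₂ x ≤ C.clampExt f T₁ x :=
  hf.anti _ (Subtype.prop _) (Subtype.prop _) (Subtype.prop _) (monotone_projIcc _ hT)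

theorem Admissible.clampExt_lip (hf : C.Admissible f) {T₁ T₂ : ℝ} (hT : T₁ ≤ T₂) (x : ℝ) :
    C.clampExt f T₁ x ≤ C.clampExt f T₂ x + C.MT * (T₂ - T₁) := by
  have hm : (projIcc C.T₀ C.Tc C.hT₀₂.le T₁ : ℝ) ≤ projIcc C.T₀ C.Tc C.hT₀₂.le T₂ :=
    monotone_projIcc _ hT
  have h1 := hf.lip _ (projIcc C.T₀ C.Tc C.hT₀₂.le T₁).2 _
    (projIcc C.T₀ C.Tc C.hT₀₂.le T₂).2 hm _ (projIcc C.eps C.om C.hepsom.le x).2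
  have h2 := (LipschitzWith.projIcc C.hT₀₂.le).dist_le_mul T₂ T₁
  rw [Subtype.dist_eq, Real.dist_eq, Real.dist_eq, abs_of_nonneg (sub_nonneg.2 hm),
    abs_of_nonneg (sub_nonneg.2 hT), NNReal.coe_one, one_mul] at h2
  exact h1.trans (add_le_add_right (mul_le_mul_of_nonneg_left h2 C.MT_pos.le) _)

theorem Admissible.clampExt_le (hf : C.Admissible f) {T₁ T x : ℝ} (hT₁ : T₁ ∈ Icc C.T₀ C.Tc)
    (hT : T₁ ≤ T) : C.clampExt f T x ≤ C.Δ₂ T₁ ^ 2 := by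
  refine (hf.clampExt_anti hT x).trans ?_
  rw [clampExt, projIcc_of_mem _ hT₁]
  exact hf.le_Δ₂ T₁ hT₁ _ (Subtype.prop _)

theorem Admissible.clampExt_eq_zero (hf : C.Admissible f) {T : ℝ} (hT : C.Tc ≤ T) (x : ℝ) :
    C.clampExt f T x = 0 := by
  rw [clampExt, projIcc_of_right_le _ hT]
  exact hf.zero _ (Subtype.prop _)

theorem Admissible.exists_clampExt_modulus (hf : C.Admissible f) {δ : ℝ} (hδ : 0 < δ) :
    ∃ η > 0, ∀ T x T' x' : ℝ, |T - T'| < η → |x - x'| < η →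
      |C.clampExt f T x - C.clampExt f T' x'| < δ := by
  obtain ⟨η, hη, h⟩ := Metric.uniformContinuousOn_iff.1
    ((isCompact_Icc.prod isCompact_Icc).uniformContinuousOn_of_continuous hf.cont) δ hδ
  refine ⟨η, hη, fun T x T' x' hT hx => ?_⟩
  refine h (projIcc C.T₀ C.Tc C.hT₀₂.le T, projIcc C.eps C.om C.hepsom.le x)
    ⟨Subtype.prop _, Subtype.prop _⟩
    (projIcc C.T₀ C.Tc C.hT₀₂.le T', projIcc C.eps C.om C.hepsom.le x')
    ⟨Subtype.prop _, Subtype.prop _⟩ ?_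
  have h1 := (LipschitzWith.projIcc C.hT₀₂.le).dist_le_mul T T'
  have h2 := (LipschitzWith.projIcc C.hepsom.le).dist_le_mul x x'
  rw [NNReal.coe_one, one_mul, Subtype.dist_eq] at h1 h2
  rw [Prod.dist_eq]
  exact max_lt (h1.trans_lt hT) (h2.trans_lt hx)

theorem Admissible.exists_smooth_near (hf : C.Admissible f) {δ : ℝ} (hδ : 0 < δ) :
    ∃ g : ℝ → ℝ → ℝ, ContDiff ℝ 2 (fun p : ℝ × ℝ => g p.1 p.2) ∧ C.Admissible g ∧
      (∃ h > 0, ∀ T > C.Tc - h, ∀ x, g T x = 0) ∧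
      ∀ T ∈ Icc C.T₀ C.Tc, ∀ x ∈ Icc C.eps C.om, |g T x - f T x| ≤ δ := by
  obtain ⟨η, hη, hmod⟩ := hf.exists_clampExt_modulus hδ
  obtain ⟨h, hh, hhη⟩ : ∃ h > 0, 3 * h < η := ⟨η / 4, by positivity, by linarith⟩
  let φ : ContDiffBump (0 : ℝ × ℝ) := ⟨h / 2, h, by positivity, by linarith⟩
  have hball : ∀ y ∈ Metric.ball (0 : ℝ × ℝ) φ.rOut, |y.1| < h ∧ |y.2| < h := fun y hy => by
    have : ‖y‖ < h := by simpa using hy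
    rwa [Prod.norm_def, max_lt_iff] at this
  have hFc := hf.continuous_clampExt
  let u : ℝ → ℝ → ℝ × ℝ → ℝ := fun T x y => C.clampExt f (T - y.1 + 2 * h) (x - y.2)
  have hu : ∀ T x, Continuous (u T x) := fun T x =>
    hFc.comp (f := fun y : ℝ × ℝ => (T - y.1 + 2 * h, x - y.2)) (by fun_prop)
  let g : ℝ → ℝ → ℝ := fun T x => ∫ y, φ.normed volume y * u T x y
  have hle : ∀ {T x c}, (∀ y : ℝ × ℝ, |y.1| < h → |y.2| < h → u T x y ≤ c) → g T x ≤ c :=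
    fun {T x c} hc => (integral_normed_mul_mono φ (hu T x) continuous_const fun y hy =>
      hc y (hball y hy).1 (hball y hy).2).trans_eq (integral_normed_mul_const φ c)
  have hge : ∀ {T x c}, (∀ y : ℝ × ℝ, |y.1| < h → |y.2| < h → c ≤ u T x y) → c ≤ g T x :=
    fun {T x c} hc => (integral_normed_mul_const φ c).symm.trans_le
      (integral_normed_mul_mono φ continuous_const (hu T x) fun y hy =>
        hc y (hball y hy).1 (hball y hy).2)
  have hint : ∀ T x, Integrable fun y => φ.normed volume y * u T x y := fun T x =>
    (φ.continuous_normed.mul (hu T x)).integrable_of_hasCompactSupport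
      φ.hasCompactSupport_normed.mul_right
  have hsmooth : ContDiff ℝ 2 (fun p : ℝ × ℝ => g p.1 p.2) := by
    have hF : Continuous fun q : ℝ × ℝ => C.clampExt f (q.1 + 2 * h) q.2 :=
      hFc.comp (f := fun q : ℝ × ℝ => (q.1 + 2 * h, q.2)) (by fun_prop)
    exact φ.hasCompactSupport_normed.contDiff_convolution_left
      (ContinuousLinearMap.lsmul ℝ ℝ) φ.contDiff_normed
      (hF.locallyIntegrable (μ := volume))
  have hzero : ∀ T > C.Tc - h, ∀ x, g T x = 0 := fun T hT x => by
    have : ∀ y : ℝ × ℝ, |y.1| < h → u T x y = 0 := fun y hy =>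
      hf.clampExt_eq_zero (by linarith [(abs_lt.1 hy).2]) _
    exact le_antisymm (hle fun y hy _ => (this y hy).le) (hge fun y hy _ => (this y hy).ge)
  refine ⟨g, hsmooth, ?_, ⟨h, hh, hzero⟩, fun T hT x hx => ?_⟩
  · exact
    { cont := hsmooth.continuous.continuousOn
      nonneg := fun T hT x hx => hge fun y _ _ => hf.clampExt_nonneg _ _
      le_Δ₂ := fun T hT x hx => hle fun y hy _ =>
        hf.clampExt_le hT (by linarith [(abs_lt.1 hy).2])
      zero := fun x _ => hzero _ (by linarith) x
      ratio := fun T hT x hx x₁ hx₁ => by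
        dsimp only [g]
        rw [← integral_const_mul]
        simp only [mul_left_comm C.a]
        exact integral_normed_mul_mono φ (hu T x) ((hu T x₁).const_mul _) fun y _ =>
          hf.clampExt_ratio _ _ _
      anti := fun x hx T₁ hT₁ T₂ hT₂ hT => integral_normed_mul_mono φ (hu T₂ x) (hu T₁ x)
        fun y _ => hf.clampExt_anti (by linarith) _
      lip := fun T₁ hT₁ T₂ hT₂ hT x hx => by
        have h1 := integral_normed_mul_mono φ (hu T₁ x)
          ((hu T₂ x).add (continuous_const (y := C.MT * (T₂ - T₁)))) fun y _ => by
            have := hf.clampExt_lip (T₁ := T₁ - y.1 + 2 * h) (T₂ := T₂ - y.1 + 2 * h)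
              (by linarith) (x - y.2)
            rwa [show T₂ - y.1 + 2 * h - (T₁ - y.1 + 2 * h) = T₂ - T₁ by ring] at this
        simp only [Pi.add_apply, mul_add] at h1
        rwa [integral_add (hint T₂ x) (φ.integrable_normed.mul_const _),
          integral_normed_mul_const] at h1 }
  · have hm : ∀ y : ℝ × ℝ, |y.1| < h → |y.2| < h → |u T x y - f T x| < δ := fun y h1 h2 => by
      rw [← clampExt_of_mem (f := f) hT hx]
      rw [abs_lt] at h1
      refine hmod _ _ _ _ (abs_lt.2 ⟨by linarith, by linarith⟩) ?_
      rw [sub_sub_cancel_left, abs_neg]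
      linarith
    rw [abs_le]
    constructor
    · linarith [hge (T := T) (x := x) (c := f T x - δ) fun y h1 h2 => by
        linarith [(abs_lt.1 (hm y h1 h2)).1]]
    · linarith [hle (T := T) (x := x) (c := f T x + δ) fun y h1 h2 => by
        linarith [(abs_lt.1 (hm y h1 h2)).2]]

end BCSContext

namespace BCSContext

variable {C : BCSContext} {f g : ℝ → ℝ → ℝ}

theorem differentiable_fst_of_contDiff (hg : ContDiff ℝ 2 (fun p : ℝ × ℝ => g p.1 p.2))
    (x : ℝ) : Differentiable ℝ fun T => g T x :=
  (hg.differentiable two_ne_zero).comp (f := fun T => (T, x)) (by fun_prop)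

theorem Admissible.pderivT_nonpos (hg : C.Admissible g) {x : ℝ} (hx : x ∈ Icc C.eps C.om)
    (T : ℝ) : pderivT C g T x ≤ 0 :=
  (hg.anti x hx).derivWithin_nonpos

theorem Admissible.neg_pderivT_le (hg : C.Admissible g) {T x : ℝ} (hT : T ∈ Icc C.T₀ C.Tc)
    (hx : x ∈ Icc C.eps C.om)
    (hd : DifferentiableWithinAt ℝ (fun T => g T x) (Icc C.T₀ C.Tc) T) :
    -pderivT C g T x ≤ C.MT := by
  have hmono : MonotoneOn (fun T => g T x + C.MT * T) (Icc C.T₀ C.Tc) :=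
    fun T₁ hT₁ T₂ hT₂ h => by linarith [hg.lip T₁ hT₁ T₂ hT₂ h x hx]
  have h1 := (hd.hasDerivWithinAt.add
    ((hasDerivWithinAt_id T _).const_mul C.MT)).derivWithin (uniqueDiffOn_Icc C.hT₀₂ T hT)
  have h2 := hmono.derivWithin_nonneg.trans_eq h1
  rw [pderivT]
  linarith

/-- A smooth admissible function vanishing near `Tc` lands in `W` after mixing in a multiple of
`Tc - T`. -/
theorem Admissible.memW_mix (hg : C.Admissible g)
    (hsm : ContDiff ℝ 2 (fun p : ℝ × ℝ => g p.1 p.2)) {h : ℝ} (hh : 0 < h)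
    (hgz : ∀ T > C.Tc - h, ∀ x, g T x = 0) {c θ : ℝ} (hc : 0 < c) (hcM : c ≤ C.MT)
    (hcΔ : ∀ T ∈ Icc C.T₀ C.Tc, c * (C.Tc - T) ≤ C.Δ₂ T ^ 2) (hθ : 0 < θ) (hθ1 : θ ≤ 1) :
    memW C fun T x => (1 - θ) * g T x + θ * (c * (C.Tc - T)) := by
  have hd := differentiable_fst_of_contDiff hsm
  have hθ' := sub_nonneg.2 hθ1
  have hMT := C.MT_pos
  have hder : ∀ T ∈ Icc C.T₀ C.Tc, ∀ x,
      pderivT C (fun T x => (1 - θ) * g T x + θ * (c * (C.Tc - T))) T x =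
        (1 - θ) * pderivT C g T x - θ * c := fun T hT x => by
    have h1 := ((((hd x T).differentiableWithinAt (s := Icc C.T₀ C.Tc)).hasDerivWithinAt.const_mul
      (1 - θ)).add ((((hasDerivWithinAt_id T _).const_sub C.Tc).const_mul c).const_mul
        θ)).derivWithin (uniqueDiffOn_Icc C.hT₀₂ T hT)
    refine Eq.trans h1 ?_
    rw [pderivT]
    ring
  have hlin : ∀ T ∈ Icc C.T₀ C.Tc, 0 ≤ c * (C.Tc - T) := fun T hT =>
    mul_nonneg hc.le (sub_nonneg.2 hT.2)
  have hTc := right_mem_Icc.2 C.hT₀₂.le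
  refine ⟨?_, fun T hT x hx => ⟨?_, ?_⟩, fun x hx => ?_, fun T hT x hx x₁ hx₁ => ?_,
    fun x hx x₁ hx₁ => ?_, fun T hT x hx => ?_, fun T hT x hx => ?_⟩
  · exact ((contDiff_const.mul hsm).add (contDiff_const.mul
      (contDiff_const.mul (contDiff_const.sub contDiff_fst)))).contDiffOn
  · rw [C.hΔ₁zero T (C.hT₀₁.le.trans hT.1)]
    have := mul_nonneg hθ' (hg.nonneg T hT x hx)
    have := mul_nonneg hθ.le (hlin T hT)
    dsimp only
    linarith
  · have := mul_le_mul_of_nonneg_left (hg.le_Δ₂ T hT x hx) hθ'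
    have := mul_le_mul_of_nonneg_left (hcΔ T hT) hθ.le
    dsimp only
    linarith
  · simp [hg.zero x hx]
  · have hT' := Ico_subset_Icc_self hT
    have := mul_le_mul_of_nonneg_left (hg.ratio T hT' x hx x₁ hx₁) hθ'
    have := le_mul_of_one_le_left (mul_nonneg hθ.le (hlin T hT')) C.one_le_a
    dsimp only
    linarith
  · have hz : ∀ y, pderivT C g C.Tc y = 0 := fun y => by
      have : (fun T => g T y) =ᶠ[𝓝[Icc C.T₀ C.Tc] C.Tc] fun _ => 0 :=
        mem_nhdsWithin_of_mem_nhds <| (eventually_gt_nhds (sub_lt_self C.Tc hh)).mono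
          fun T hT => hgz T hT y
      rw [pderivT, this.derivWithin_eq (hgz _ (sub_lt_self _ hh) _), derivWithin_fun_const]
      rfl
    rw [hder _ hTc, hder _ hTc, hz, hz]
    have := le_mul_of_one_le_left (mul_pos hθ hc).le C.one_le_a
    linarith
  · rw [hder T hT]
    have := mul_nonpos_of_nonneg_of_nonpos hθ' (hg.pderivT_nonpos hx T)
    have := mul_pos hθ hc
    linarith
  · rw [hder T hT]
    have := mul_le_mul_of_nonneg_left (hg.neg_pderivT_le hT hx (hd x T).differentiableWithinAt)
      hθ'
    have := mul_le_mul_of_nonneg_left hcM hθ.le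
    linarith

theorem mem_closure_of_admissible {F : C(↥C.Dset, ℝ)} (hF : C.Admissible (extFun C F)) :
    F ∈ closure (WSet C) := by
  refine Metric.mem_closure_iff.2 fun δ hδ => ?_
  obtain ⟨g, hsm, hg, ⟨h, hh, hgz⟩, hgF⟩ := hF.exists_smooth_near (half_pos (half_pos hδ))
  obtain ⟨c, hc, hcM, hcΔ⟩ := exists_pos_mul_le_Δ₂_sq (C := C)
  set B := C.Δ₂ C.T₀ ^ 2
  have hB : 0 ≤ B := sq_nonneg _
  have hΔB : ∀ T ∈ Icc C.T₀ C.Tc, C.Δ₂ T ^ 2 ≤ B := fun T hT =>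
    pow_le_pow_left₀ (C.hΔ₂nonneg T) (C.Δ₂_le hT) 2
  obtain ⟨θ, hθ, hθ1, hθB⟩ : ∃ θ : ℝ, 0 < θ ∧ θ ≤ 1 ∧ θ * B ≤ δ / 4 := by
    refine ⟨δ / (4 * B + δ), by positivity, div_le_one_of_le₀ (by linarith) (by positivity), ?_⟩
    rw [div_mul_eq_mul_div, div_le_div_iff₀ (by positivity) (by norm_num)]
    nlinarith
  have hw := hg.memW_mix hsm hh hgz hc hcM hcΔ hθ hθ1
  refine ⟨⟨fun p => (1 - θ) * g p.1.1 p.1.2 + θ * (c * (C.Tc - p.1.1)),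
    continuousOn_iff_continuous_domRestrict.1 hw.1.continuousOn⟩, ⟨_, hw, fun p => rfl⟩, ?_⟩
  refine (ContinuousMap.dist_lt_iff hδ).2 fun ⟨⟨T, x⟩, hT, hx⟩ => ?_
  rw [← extFun_of_mem F hT hx, dist_comm, Real.dist_eq]
  change |(1 - θ) * g T x + θ * (c * (C.Tc - T)) - extFun C F T x| < δ
  have h1 := abs_le.1 (hgF T hT x hx)
  have h2 := mul_le_mul_of_nonneg_left ((hcΔ T hT).trans (hΔB T hT)) hθ.le
  have h3 : 0 ≤ θ * (c * (C.Tc - T)) :=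
    mul_nonneg hθ.le (mul_nonneg hc.le (sub_nonneg.2 hT.2))
  have h4 := mul_le_mul_of_nonneg_left ((hg.le_Δ₂ T hT x hx).trans (hΔB T hT)) hθ.le
  have h5 := mul_nonneg hθ.le (hg.nonneg T hT x hx)
  refine abs_lt.2 ⟨?_, ?_⟩ <;> linarith

theorem mem_closure_iff_admissible {F : C(↥C.Dset, ℝ)} :
    F ∈ closure (WSet C) ↔ C.Admissible (extFun C F) :=
  ⟨admissible_of_mem_closure, mem_closure_of_admissible⟩

theorem tendstoUniformlyOn_opA {G : C(↥C.Dset, ℝ)} {h : ℕ → C(↥C.Dset, ℝ)}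
    (hG : C.Admissible (extFun C G)) (hh : ∀ n, C.Admissible (extFun C (h n)))
    (hlim : Tendsto h atTop (𝓝 G)) :
    TendstoUniformlyOn (fun n (p : ℝ × ℝ) => opA C (extFun C (h n)) p.1 p.2)
      (fun p : ℝ × ℝ => opA C (extFun C G) p.1 p.2) atTop C.Dset := by
  rw [Metric.tendstoUniformlyOn_iff]
  intro δ hδ
  have hd : Tendsto (fun n => 2 * C.gapBound *
      (C.U₂ * (√(dist G (h n)) / C.eps) * (C.om - C.eps))) atTop (𝓝 0) := by
    have h1 := (Real.continuous_sqrt.tendsto _).comp ((tendsto_const_nhds (x := G)).dist hlim)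
    have h2 := (((h1.div_const C.eps).const_mul C.U₂).mul_const (C.om - C.eps)).const_mul
      (2 * C.gapBound)
    simpa using h2
  filter_upwards [hd.eventually_lt_const hδ] with n hn p hp
  refine (hG.abs_opA_sub_opA_le (hh n) (fun T hT x hx => ?_) hp.1 hp.2).trans_lt hn
  rw [extFun_of_mem _ hT hx, extFun_of_mem _ hT hx, ← Real.dist_eq]
  exact ContinuousMap.dist_apply_le_dist _

theorem isCompact_closure_range_opA (hcond : gapCondition C) :
    IsCompact (closure {F : C(↥C.Dset, ℝ) | ∃ G, C.Admissible (extFun C G) ∧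
      ∀ p : ↥C.Dset, F p = opA C (extFun C G) (p : ℝ × ℝ).1 (p : ℝ × ℝ).2}) := by
  set R := {F : C(↥C.Dset, ℝ) | ∃ G, C.Admissible (extFun C G) ∧
    ∀ p : ↥C.Dset, F p = opA C (extFun C G) (p : ℝ × ℝ).1 (p : ℝ × ℝ).2}
  let e := (ContinuousMap.isometryEquivBoundedOfCompact ↥C.Dset ℝ).toHomeomorph
  rw [← e.isCompact_image, e.image_closure]
  refine BoundedContinuousFunction.arzela_ascoli (Icc (-C.gapBound ^ 2) (C.gapBound ^ 2))
    isCompact_Icc _ ?_ fun p => Metric.equicontinuousAt_iff.2 fun δ hδ => ?_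
  · rintro _ p ⟨F, ⟨G, hG, hF⟩, rfl⟩
    exact abs_le.1 ((congrArg abs (hF p)).trans_le (hG.abs_opA_le p.2.1 p.2.2))
  · obtain ⟨η, hη, h⟩ := exists_opA_modulus hcond hδ
    refine ⟨η, hη, ?_⟩
    rintro q hq ⟨_, F, ⟨G, hG, hF⟩, rfl⟩
    rw [dist_comm] at hq
    refine lt_of_eq_of_lt ?_ (h _ hG p.1 p.2 q.1 q.2 hq)
    rw [← hF, ← hF]
    rfl

theorem admissible_zero : C.Admissible fun _ _ => 0 where
  cont := continuousOn_const
  nonneg _ _ _ _ := le_rfl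
  le_Δ₂ _ _ _ _ := sq_nonneg _
  zero _ _ := rfl
  ratio _ _ _ _ _ _ := (mul_zero _).ge
  anti _ _ := antitoneOn_const
  lip T₁ _ T₂ _ hT _ _ := by
    have := mul_nonneg C.MT_pos.le (sub_nonneg.2 hT)
    linarith

theorem admissible_extFun_zero : C.Admissible (extFun C 0) :=
  admissible_zero.congr fun _ hT _ hx => extFun_of_mem 0 hT hx

theorem opA_extFun_zero (p : ↥C.Dset) :
    opA C (extFun C 0) (p : ℝ × ℝ).1 (p : ℝ × ℝ).2 = 0 := by
  rw [admissible_extFun_zero.opA_eq p.2.1,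
    gapIntegral_of_eq_zero fun ξ hξ => extFun_of_mem 0 p.2.1 hξ]
  simp

theorem exists_eq_opA (hcond : gapCondition C) {G : C(↥C.Dset, ℝ)}
    (hG : C.Admissible (extFun C G)) :
    ∃ F : C(↥C.Dset, ℝ), C.Admissible (extFun C F) ∧
      ∀ p : ↥C.Dset, F p = opA C (extFun C G) (p : ℝ × ℝ).1 (p : ℝ × ℝ).2 := by
  have h := hG.opA hcond
  let F : C(↥C.Dset, ℝ) := ⟨fun p => opA C (extFun C G) p.1.1 p.1.2,
    continuousOn_iff_continuous_domRestrict.1 h.cont⟩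
  exact ⟨F, h.congr fun T hT x hx => extFun_of_mem F hT hx, fun _ => rfl⟩

end BCSContext

theorem stmt_17 (C : BCSContext) (hcond : gapCondition C) :
    (∀ G ∈ closure (WSet C), ∃ F ∈ closure (WSet C),
        ∀ p : ↥C.Dset, F p = opA C (extFun C G) (p : ℝ × ℝ).1 (p : ℝ × ℝ).2) ∧
    (∀ G ∈ closure (WSet C), ∀ h : ℕ → C(↥C.Dset, ℝ),
        (∀ n, h n ∈ closure (WSet C)) → Tendsto h atTop (𝓝 G) →
        TendstoUniformlyOn (fun n (p : ℝ × ℝ) => opA C (extFun C (h n)) p.1 p.2)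
          (fun p : ℝ × ℝ => opA C (extFun C G) p.1 p.2) atTop C.Dset) ∧
    (∃ M : ℝ, ∀ G ∈ closure (WSet C), ∀ p ∈ C.Dset, |opA C (extFun C G) p.1 p.2| ≤ M) ∧
    (∀ δ > (0 : ℝ), ∃ η > (0 : ℝ), ∀ G ∈ closure (WSet C), ∀ p ∈ C.Dset, ∀ q ∈ C.Dset,
        dist p q < η → |opA C (extFun C G) p.1 p.2 - opA C (extFun C G) q.1 q.2| < δ) ∧
    IsCompact (closure {F : C(↥C.Dset, ℝ) | ∃ G ∈ closure (WSet C),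
        ∀ p : ↥C.Dset, F p = opA C (extFun C G) (p : ℝ × ℝ).1 (p : ℝ × ℝ).2}) ∧
    (∃! F : C(↥C.Dset, ℝ), F ∈ closure (WSet C) ∧
        ∀ p : ↥C.Dset, F p = opA C (extFun C F) (p : ℝ × ℝ).1 (p : ℝ × ℝ).2) := by
  simp only [BCSContext.mem_closure_iff_admissible]
  refine ⟨fun G hG => BCSContext.exists_eq_opA hcond hG,
    fun G hG h hh hlim => BCSContext.tendstoUniformlyOn_opA hG hh hlim,
    ⟨C.gapBound ^ 2, fun G hG p hp => hG.abs_opA_le hp.1 hp.2⟩, fun δ hδ => ?_,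
    BCSContext.isCompact_closure_range_opA hcond,
    0, ⟨BCSContext.admissible_extFun_zero, fun p => (BCSContext.opA_extFun_zero p).symm⟩, ?_⟩
  · obtain ⟨η, hη, h⟩ := BCSContext.exists_opA_modulus hcond hδ
    exact ⟨η, hη, fun G hG => h _ hG⟩
  · rintro F ⟨hF, hfix⟩
    ext ⟨⟨T, x⟩, hT, hx⟩
    rw [← BCSContext.extFun_of_mem F hT hx]
    exact hF.eq_zero_of_eq_opA hcond
      (fun T hT x hx => (BCSContext.extFun_of_mem F hT hx).trans (hfix ⟨(T, x), hT, hx⟩)) hT hx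

end
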